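/- arXiv:2204.13297 — 3 statements merged into one kernel-verified Lean document; each statement's English description precedes it below -/
import Mathlib

section
/- For every k ≥ 2, MLR is not positively Medvedev reducible to Some(MLR, k): there is no positive reduction Φ such that Φ^X ∈ MLR for every X ∈ Some(MLR, k). -/
open MeasureTheory

/-- Cantor space `2^ω`: functions from `ℕ` to `Bool`. -/
abbrev Cantor : Type := ℕ → Bool

/-- The fair-coin product measure on Cantor space (each bit is `true` with probability 1/2,
independently), realized concretely as the pushforward of Lebesgue measure on `[0,1)`
under the binary-digit map `x ↦ (n ↦ n-th binary digit of x)`. -/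
noncomputable def fairCoin : Measure Cantor :=
  Measure.map (fun (x : ℝ) (n : ℕ) => decide ((⌊x * 2 ^ (n + 1)⌋ % 2 : ℤ) = 1))
    (volume.restrict (Set.Ico (0 : ℝ) 1))

/-- The cylinder `[σ]` of all `X ∈ 2^ω` extending the finite binary string `σ`. -/
def cylinder (σ : List Bool) : Set Cantor :=
  {X | ∀ (i : ℕ) (h : i < σ.length), X i = σ.get ⟨i, h⟩}

/-- The `n`-th level `U_n` of a test `U`: the union of the cylinders enumerated by `U n`. -/
def testSet (U : ℕ → ℕ → Option (List Bool)) (n : ℕ) : Set Cantor :=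
  ⋃ σ ∈ {σ : List Bool | ∃ k, U n k = some σ}, cylinder σ

/-- A Martin-Löf test: a computable enumeration of cylinders with `μ(U_n) ≤ 2^{-n}`. -/
def MLTest (U : ℕ → ℕ → Option (List Bool)) : Prop :=
  Computable₂ U ∧ ∀ n, fairCoin (testSet U n) ≤ ((2 : ENNReal) ^ n)⁻¹

/-- The Martin-Löf random elements of Cantor space. -/
def MLR : Set Cantor :=
  {X | ∀ U : ℕ → ℕ → Option (List Bool), MLTest U → ∃ n, X ∉ testSet U n}

/-- The `i`-th of `k` interleaved columns of `X`: `X_i(n) = X(k·n + i)`. -/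
def colK (k : ℕ) (X : Cantor) (i : ℕ) : Cantor := fun n => X (k * n + i)

/-- `Some(C, k)`: some column `i < k` is in `C`. -/
def SomeK (C : Set Cantor) (k : ℕ) : Set Cantor := {X | ∃ i < k, colK k X i ∈ C}

/-- The output `Φ^X` of the positive reduction given by the positive CNFs `c n`:
`Φ^X(n) = ⋀_{clause ∈ c n} ⋁_{i ∈ clause} X(i)`, with an empty conjunction true and an
empty disjunction false. -/
def posEval (c : ℕ → List (List ℕ)) (X : Cantor) : Cantor :=
  fun n => (c n).all fun clause => clause.any fun i => X i


/-- The binary digit map used in `fairCoin`. -/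
noncomputable def dig : ℝ → Cantor :=
  fun (x : ℝ) (n : ℕ) => decide ((⌊x * 2 ^ (n + 1)⌋ % 2 : ℤ) = 1)

/-- The length `L` bit pattern of `m`. -/
def pat (L m : ℕ) : Cantor := fun n => decide (m / 2 ^ (L - 1 - n) % 2 = 1)

lemma measurable_dig : Measurable dig := by
  refine measurable_pi_lambda _ fun n => ?_
  have h1 : Measurable (fun x : ℝ => ⌊x * 2 ^ (n + 1)⌋) :=
    Int.measurable_floor.comp (measurable_id.mul_const _)
  have h2 : Measurable (fun z : ℤ => decide ((z % 2 : ℤ) = 1)) := measurable_from_top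
  exact h2.comp h1

instance : IsProbabilityMeasure fairCoin := by
  have : IsProbabilityMeasure (volume.restrict (Set.Ico (0 : ℝ) 1)) := ⟨by simp⟩
  exact Measure.isProbabilityMeasure_map (f := dig) measurable_dig.aemeasurable

lemma dig_eq_pat {L m n : ℕ} {x : ℝ} (hn : n < L) (h : ⌊x * 2 ^ L⌋ = (m : ℤ)) :
    dig x n = pat L m n := by
  have h1 : x * 2 ^ (n + 1) = x * 2 ^ L / ((2 ^ (L - 1 - n) : ℕ) : ℝ) := by
    have : L = (n + 1) + (L - 1 - n) := by omega
    rw [eq_div_iff (by positivity)]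
    push_cast
    rw [mul_assoc, ← pow_add, ← this]
  have h2 : ⌊x * 2 ^ (n + 1)⌋ = ((m / 2 ^ (L - 1 - n) : ℕ) : ℤ) := by
    rw [h1, Int.floor_div_natCast, h]
    simp
  unfold dig pat
  rw [h2]
  congr 1
  apply propext
  omega

lemma floor_eq_iff' (L m : ℕ) (x : ℝ) : ⌊x * 2 ^ L⌋ = (m : ℤ) ↔
    x ∈ Set.Ico ((m : ℝ) / 2 ^ L) ((m + 1 : ℝ) / 2 ^ L) := by
  rw [Int.floor_eq_iff, Set.mem_Ico, div_le_iff₀ (by positivity), lt_div_iff₀ (by positivity)]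
  simp

lemma meas_of_dep (L : ℕ) (P : Cantor → Prop)
    (hP : ∀ X Y : Cantor, (∀ n < L, X n = Y n) → (P X ↔ P Y)) : MeasurableSet {X | P X} := by
  let r : Cantor → (Fin L → Bool) := fun X i => X i
  have hr : Measurable r := measurable_pi_lambda _ fun i => measurable_pi_apply _
  have : {X | P X} = r ⁻¹' (r '' {X | P X}) := by
    ext X
    constructor
    · intro h; exact ⟨X, h, rfl⟩
    · rintro ⟨Y, hY, h⟩
      refine (hP Y X ?_).1 hY
      intro n hn
      exact congrFun h ⟨n, hn⟩
  rw [this]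
  exact hr (Set.toFinite _).measurableSet

lemma fairCoin_dep (L : ℕ) (P : Cantor → Prop) [DecidablePred P]
    (hP : ∀ X Y : Cantor, (∀ n < L, X n = Y n) → (P X ↔ P Y)) :
    fairCoin.real {X | P X} =
      (((Finset.range (2 ^ L)).filter fun m => P (pat L m)).card : ℝ) / 2 ^ L := by
  have hm := meas_of_dep L P hP
  have e1 : fairCoin.real {X | P X} = volume.real (dig ⁻¹' {X | P X} ∩ Set.Ico (0 : ℝ) 1) := by
    rw [measureReal_def, measureReal_def]
    congr 1
    rw [← Measure.restrict_apply (measurable_dig hm)]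
    exact Measure.map_apply measurable_dig hm
  have e2 : dig ⁻¹' {X | P X} ∩ Set.Ico (0 : ℝ) 1 =
      ⋃ m ∈ (Finset.range (2 ^ L)).filter (fun m => P (pat L m)),
        Set.Ico ((m : ℝ) / 2 ^ L) ((m + 1 : ℝ) / 2 ^ L) := by
    ext x
    simp only [Set.mem_inter_iff, Set.mem_preimage, Set.mem_ofPred_eq, Set.mem_iUnion,
      Finset.mem_filter, Finset.mem_range, exists_prop, ← floor_eq_iff']
    constructor
    · rintro ⟨hx, h0, h1⟩
      have hf0 : 0 ≤ ⌊x * 2 ^ L⌋ := Int.floor_nonneg.2 (by positivity)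
      obtain ⟨m, hm⟩ := Int.eq_ofNat_of_zero_le hf0
      refine ⟨m, ⟨?_, ?_⟩, hm⟩
      · have : ⌊x * 2 ^ L⌋ < 2 ^ L := by
          rw [Int.floor_lt]
          push_cast
          exact mul_lt_of_lt_one_left (by positivity) h1
        rw [hm] at this
        exact_mod_cast this
      · exact (hP _ _ fun n hn => dig_eq_pat hn hm).1 hx
    · rintro ⟨m, ⟨hm, hp⟩, hx⟩
      refine ⟨(hP _ _ fun n hn => dig_eq_pat hn hx).2 hp, ?_⟩
      rw [floor_eq_iff'] at hx
      have hm' : (m + 1 : ℝ) ≤ 2 ^ L := by exact_mod_cast hm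
      refine ⟨le_trans (by positivity) hx.1, lt_of_lt_of_le hx.2 ?_⟩
      rw [div_le_one (by positivity)]
      exact hm'
  rw [e1, e2, measureReal_biUnion_finset (h := fun b _ => by
    rw [Real.volume_Ico]; exact ENNReal.ofReal_ne_top)]
  · have : ∀ m : ℕ, volume.real (Set.Ico ((m : ℝ) / 2 ^ L) ((m + 1 : ℝ) / 2 ^ L)) = 1 / 2 ^ L := by
      intro m
      rw [Real.volume_real_Ico_of_le (by gcongr; linarith)]
      ring
    simp only [this, Finset.sum_const, nsmul_eq_mul]
    ring
  · intro a _ b _ hab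
    rw [Function.onFun, Set.disjoint_left]
    intro x hx hx'
    rw [← floor_eq_iff'] at hx hx'
    exact hab (by exact_mod_cast hx.symm.trans hx')
  · intro m _; exact measurableSet_Ico

/-- Number of agreements of `X` and `d` below `N`. -/
def agr (d X : Cantor) (N : ℕ) : ℕ := ∑ i ∈ Finset.range N, if X i = d i then 1 else 0

lemma agr_le (d X : Cantor) (N : ℕ) : agr d X N ≤ N := by
  unfold agr
  calc _ ≤ ∑ i ∈ Finset.range N, 1 := Finset.sum_le_sum fun i _ => by split_ifs <;> simp
    _ = N := by simp

lemma agr_congr (d : Cantor) {X Y : Cantor} {N : ℕ} (h : ∀ n < N, X n = Y n) :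
    agr d X N = agr d Y N :=
  Finset.sum_congr rfl fun i hi => by rw [h i (Finset.mem_range.1 hi)]

lemma sum_range_two_mul (g : ℕ → ℕ) (K : ℕ) :
    ∑ m ∈ Finset.range (2 * K), g m = ∑ m ∈ Finset.range K, (g (2 * m) + g (2 * m + 1)) := by
  induction K with
  | zero => simp
  | succ K ih =>
    rw [show 2 * (K + 1) = 2 * K + 1 + 1 by ring, Finset.sum_range_succ, Finset.sum_range_succ,
      Finset.sum_range_succ, ih]
    ring

lemma pat_succ {L m b n : ℕ} (hb : b < 2) (hn : n < L) : pat (L + 1) (2 * m + b) n = pat L m n := by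
  unfold pat
  have h : L + 1 - 1 - n = (L - 1 - n) + 1 := by omega
  rw [h, pow_succ', ← Nat.div_div_eq_div_mul]
  have : (2 * m + b) / 2 = m := by omega
  rw [this]

lemma pat_last {L m b : ℕ} (hb : b < 2) : pat (L + 1) (2 * m + b) L = decide (b = 1) := by
  unfold pat
  simp
  omega

lemma sum_weights (d : Cantor) (L : ℕ) :
    ∑ m ∈ Finset.range (2 ^ L), ∏ i ∈ Finset.range L, (if pat L m i = d i then 7 else 5)
      = 12 ^ L := by
  induction L with
  | zero => simp
  | succ L ih =>
    have key : ∀ m b, b < 2 →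
        (∏ i ∈ Finset.range (L + 1), (if pat (L + 1) (2 * m + b) i = d i then 7 else 5)) =
        (∏ i ∈ Finset.range L, (if pat L m i = d i then 7 else 5)) *
          (if decide (b = 1) = d L then 7 else 5) := by
      intro m b hb
      rw [Finset.prod_range_succ, pat_last hb]
      congr 1
      exact Finset.prod_congr rfl fun i hi => by rw [pat_succ hb (Finset.mem_range.1 hi)]
    rw [pow_succ', sum_range_two_mul, pow_succ, ← ih, Finset.sum_mul]
    refine Finset.sum_congr rfl fun m _ => ?_
    have h0 := key m 0 (by norm_num)
    have h1 := key m 1 (by norm_num)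
    rw [add_zero] at h0
    rw [h0, h1, ← mul_add]
    congr 1
    cases d L <;> simp

lemma weight_eq (d X : Cantor) (N : ℕ) :
    ∏ i ∈ Finset.range N, (if X i = d i then 7 else 5) = 7 ^ agr d X N * 5 ^ (N - agr d X N) := by
  induction N with
  | zero => simp [agr]
  | succ N ih =>
    have h : agr d X (N + 1) = agr d X N + if X N = d N then 1 else 0 := by
      unfold agr; rw [Finset.sum_range_succ]
    have hle := agr_le d X N
    rw [Finset.prod_range_succ, ih, h]
    split_ifs
    · rw [show N + 1 - (agr d X N + 1) = N - agr d X N by omega]; ring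
    · rw [show N + 1 - (agr d X N + 0) = N - agr d X N + 1 by omega]; ring

lemma bad_count (d : Cantor) (j : ℕ) :
    ((Finset.range (2 ^ (60 * j))).filter fun m => 35 * j ≤ agr d (pat (60 * j) m) (60 * j)).card *
      (7 ^ (35 * j) * 5 ^ (25 * j)) ≤ 12 ^ (60 * j) := by
  rw [← sum_weights d, ← smul_eq_mul]
  refine (Finset.card_nsmul_le_sum _ _ _ ?_).trans
    (Finset.sum_le_sum_of_subset (Finset.filter_subset _ _))
  intro m hm
  rw [Finset.mem_filter] at hm
  rw [weight_eq]
  have h1 := hm.2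
  have h2 := agr_le d (pat (60 * j) m) (60 * j)
  obtain ⟨a, ha⟩ := Nat.exists_eq_add_of_le h1
  rw [ha] at h2 ⊢
  have e : 25 * j = a + (60 * j - (35 * j + a)) := by omega
  calc 7 ^ (35 * j) * 5 ^ (25 * j)
      = 7 ^ (35 * j) * (5 ^ a * 5 ^ (60 * j - (35 * j + a))) := by rw [← pow_add, ← e]
    _ ≤ 7 ^ (35 * j) * (7 ^ a * 5 ^ (60 * j - (35 * j + a))) := by gcongr; norm_num
    _ = _ := by rw [pow_add]; ring

lemma bad_measure (d : Cantor) (j : ℕ) :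
    fairCoin {X | 35 * j ≤ agr d X (60 * j)} ≤ ((2 : ENNReal) ^ j)⁻¹ := by
  have h := fairCoin_dep (60 * j) (fun X => 35 * j ≤ agr d X (60 * j)) (by
    intro X Y hXY; rw [agr_congr d hXY])
  have hr : fairCoin.real {X | 35 * j ≤ agr d X (60 * j)} ≤ (2 ^ j)⁻¹ := by
    rw [h]
    have hb := bad_count d j
    set C := ((Finset.range (2 ^ (60 * j))).filter
      fun m => 35 * j ≤ agr d (pat (60 * j) m) (60 * j)).card
    have hb' : (C : ℝ) * (7 ^ (35 * j) * 5 ^ (25 * j)) ≤ 12 ^ (60 * j) := by exact_mod_cast hb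
    have hc : (2 : ℝ) ^ j * 12 ^ (60 * j) ≤ 2 ^ (60 * j) * (7 ^ (35 * j) * 5 ^ (25 * j)) := by
      rw [pow_mul, pow_mul, pow_mul, pow_mul, ← mul_pow, ← mul_pow, ← mul_pow]
      exact pow_le_pow_left₀ (by positivity) (by norm_num) j
    rw [div_le_iff₀ (by positivity), inv_mul_eq_div, le_div_iff₀ (by positivity)]
    have hp : (0 : ℝ) < 7 ^ (35 * j) * 5 ^ (25 * j) := by positivity
    refine le_of_mul_le_mul_right ?_ hp
    calc (C : ℝ) * 2 ^ j * (7 ^ (35 * j) * 5 ^ (25 * j))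
        = 2 ^ j * (C * (7 ^ (35 * j) * 5 ^ (25 * j))) := by ring
      _ ≤ 2 ^ j * 12 ^ (60 * j) := by gcongr
      _ ≤ _ := hc
  rw [measureReal_def] at hr
  have h3 := (ENNReal.toReal_le_toReal (measure_ne_top fairCoin _) (b := ((2 : ENNReal) ^ j)⁻¹)
    (by simp)).1 (by simpa using hr)
  exact h3

/-- Agreement count of a string with `d`, in recursive form. -/
def cnt (d : Cantor) (σ : List Bool) (N : ℕ) : ℕ :=
  Nat.rec 0 (fun i acc => acc + bif decide (σ[i]? = some (d i)) then 1 else 0) N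

lemma cnt_eq (d : Cantor) (σ : List Bool) (X : Cantor) (hX : X ∈ cylinder σ) (N : ℕ)
    (hN : N ≤ σ.length) : cnt d σ N = agr d X N := by
  induction N with
  | zero => rfl
  | succ N ih =>
    have h : agr d X (N + 1) = agr d X N + if X N = d N then 1 else 0 := by
      unfold agr; rw [Finset.sum_range_succ]
    have h2 : cnt d σ (N + 1) = cnt d σ N + bif decide (σ[N]? = some (d N)) then 1 else 0 := rfl
    have h3 : X N = σ[N] := hX N (by omega)
    rw [h, h2, ih (by omega), List.getElem?_eq_getElem (by omega), ← h3]
    cases X N <;> cases d N <;> simp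

/-- The acceptance condition of the frequency test. -/
def okTest (d : Cantor) (n : ℕ) (p : ℕ × List Bool) : Bool :=
  (p.2.length == 60 * (n + 1 + p.1)) &&
    decide (35 * (n + 1 + p.1) ≤ cnt d p.2 (60 * (n + 1 + p.1)))

/-- The frequency test. -/
def freqTest (d : Cantor) (n t : ℕ) : Option (List Bool) :=
  (Encodable.decode (α := ℕ × List Bool) t).bind fun p =>
    bif okTest d n p then some p.2 else none

lemma computable_cnt {d : Cantor} (hd : Computable d) : Computable₂ (cnt d) := by
  unfold cnt
  refine Computable.nat_rec (f := fun a : List Bool × ℕ => a.2)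
    (g := fun _ => 0) (h := fun (a : List Bool × ℕ) (q : ℕ × ℕ) =>
      q.2 + bif decide (a.1[q.1]? = some (d q.1)) then 1 else 0) Computable.snd (Computable.const 0) ?_
  have hadd : Computable₂ (fun a b : ℕ => a + b) := Primrec.nat_add.to_comp
  have hbeq : Computable₂ (fun a b : Option Bool => decide (a = b)) := Primrec.eq.decide.to_comp
  refine hadd.comp (Computable.snd.comp Computable.snd) ?_
  refine Computable.cond ?_ (Computable.const 1) (Computable.const 0)
  refine hbeq.comp ?_ ?_
  · exact Computable.list_getElem?.comp (Computable.fst.comp Computable.fst)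
      (Computable.fst.comp Computable.snd)
  · exact Computable.option_some.comp (hd.comp (Computable.fst.comp Computable.snd))

lemma computable_freqTest {d : Cantor} (hd : Computable d) : Computable₂ (freqTest d) := by
  have hadd : Computable₂ (fun a b : ℕ => a + b) := Primrec.nat_add.to_comp
  have hmul : Computable₂ (fun a b : ℕ => a * b) := Primrec.nat_mul.to_comp
  have hbeq : Computable₂ (fun a b : ℕ => a == b) := Primrec.beq.to_comp
  have hle : Computable₂ (fun a b : ℕ => decide (a ≤ b)) := Primrec.nat_le.decide.to_comp
  have hand : Computable₂ and := Primrec.and.to_comp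
  refine Computable.option_bind (Computable.decode.comp Computable.snd) ?_
  have hn : Computable (fun q : (ℕ × ℕ) × (ℕ × List Bool) => q.1.1 + 1 + q.2.1) :=
    hadd.comp (hadd.comp (Computable.fst.comp Computable.fst) (Computable.const 1))
      (Computable.fst.comp Computable.snd)
  have hs : Computable (fun q : (ℕ × ℕ) × (ℕ × List Bool) => q.2.2) :=
    Computable.snd.comp Computable.snd
  have hok : Computable (fun q : (ℕ × ℕ) × (ℕ × List Bool) => okTest d q.1.1 q.2) := by
    unfold okTest
    refine hand.comp ?_ ?_
    · exact hbeq.comp (Computable.list_length.comp hs) (hmul.comp (Computable.const 60) hn)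
    · exact hle.comp (hmul.comp (Computable.const 35) hn)
        ((computable_cnt hd).comp hs (hmul.comp (Computable.const 60) hn))
  exact Computable.cond hok (Computable.option_some.comp hs) (Computable.const none)

lemma mem_freqTest {d X : Cantor} {n : ℕ} : X ∈ testSet (freqTest d) n ↔
    ∃ j, 35 * (n + 1 + j) ≤ agr d X (60 * (n + 1 + j)) := by
  unfold testSet
  simp only [Set.mem_iUnion, Set.mem_ofPred_eq, exists_prop]
  constructor
  · rintro ⟨σ, ⟨t, ht⟩, hX⟩
    unfold freqTest at ht
    rw [Option.bind_eq_some_iff] at ht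
    obtain ⟨p, -, hp⟩ := ht
    cases hok : okTest d n p with
    | false => simp [hok] at hp
    | true =>
      simp only [hok, cond_true, Option.some.injEq] at hp
      subst hp
      unfold okTest at hok
      simp only [Bool.and_eq_true, beq_iff_eq, decide_eq_true_eq] at hok
      refine ⟨p.1, ?_⟩
      rw [← cnt_eq d p.2 X hX _ hok.1.ge]
      exact hok.2
  · rintro ⟨j, hj⟩
    let σ : List Bool := (List.range (60 * (n + 1 + j))).map X
    have hl : σ.length = 60 * (n + 1 + j) := by simp [σ]
    have hX : X ∈ cylinder σ := by
      intro i hi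
      simp [σ]
    refine ⟨σ, ⟨Encodable.encode (j, σ), ?_⟩, hX⟩
    have hok : okTest d n (j, σ) = true := by
      unfold okTest
      simp only [Bool.and_eq_true, beq_iff_eq, decide_eq_true_eq]
      refine ⟨hl, ?_⟩
      rw [cnt_eq d σ X hX _ hl.ge]
      exact hj
    simp [freqTest, hok]

lemma freqTest_ml {d : Cantor} (hd : Computable d) : MLTest (freqTest d) := by
  refine ⟨computable_freqTest hd, fun n => ?_⟩
  have hsub : testSet (freqTest d) n ⊆
      ⋃ j, {X | 35 * (n + 1 + j) ≤ agr d X (60 * (n + 1 + j))} := by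
    intro X hX
    exact Set.mem_iUnion.2 (mem_freqTest.1 hX)
  calc fairCoin (testSet (freqTest d) n)
      ≤ ∑' j, fairCoin {X | 35 * (n + 1 + j) ≤ agr d X (60 * (n + 1 + j))} :=
        (measure_mono hsub).trans (measure_iUnion_le _)
    _ ≤ ∑' j : ℕ, ((2 : ENNReal) ^ n)⁻¹ * (2⁻¹ ^ (j + 1)) := by
        refine ENNReal.tsum_le_tsum fun j => (bad_measure d _).trans (le_of_eq ?_)
        rw [ENNReal.inv_pow, ENNReal.inv_pow, ← pow_add]
        congr 1; ring
    _ = ((2 : ENNReal) ^ n)⁻¹ := by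
        rw [ENNReal.tsum_mul_left, ENNReal.tsum_geometric_add_one]
        simp
        rw [ENNReal.inv_mul_cancel (by simp) (by simp), mul_one]

lemma mlr_freq {d X : Cantor} (hd : Computable d) (hX : X ∈ MLR) :
    ∃ n, ∀ j ≥ n, agr d X (60 * j) ≤ 35 * j := by
  obtain ⟨n, hn⟩ := hX _ (freqTest_ml hd)
  refine ⟨n + 1, fun j hj => ?_⟩
  by_contra hlt
  obtain ⟨i, rfl⟩ := Nat.exists_eq_add_of_le hj
  exact hn (mem_freqTest.2 ⟨i, by omega⟩)

lemma countable_computable₂ : {U : ℕ → ℕ → Option (List Bool) | Computable₂ U}.Countable := by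
  let Φ : {U : ℕ → ℕ → Option (List Bool) | Computable₂ U} → {f : ℕ → ℕ // Computable f} :=
    fun U => ⟨fun n => Encodable.encode (U.1 n.unpair.1 n.unpair.2),
      Computable.encode.comp ((show Computable₂ U.1 from U.2).comp
        (Computable.fst.comp Computable.unpair) (Computable.snd.comp Computable.unpair))⟩
  have hΦ : Function.Injective Φ := by
    intro U V h
    apply Subtype.ext
    funext a b
    have h1 := congrFun (congrArg Subtype.val h) (Nat.pair a b)
    simpa [Φ] using h1
  exact Set.countable_coe_iff.1 hΦ.countable

lemma ae_mlr : ∀ᵐ X ∂fairCoin, X ∈ MLR := by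
  have hc : {U : ℕ → ℕ → Option (List Bool) | MLTest U}.Countable :=
    countable_computable₂.mono fun U hU => hU.1
  have : ∀ᵐ X ∂fairCoin, ∀ U ∈ {U : ℕ → ℕ → Option (List Bool) | MLTest U},
      ∃ n, X ∉ testSet U n := by
    rw [ae_ball_iff hc]
    intro U hU
    rw [ae_iff]
    push Not
    refine le_antisymm ?_ bot_le
    have hlim : Filter.Tendsto (fun n : ℕ => ((2 : ENNReal) ^ n)⁻¹) Filter.atTop (nhds 0) := by
      simp_rw [ENNReal.inv_pow]
      exact ENNReal.tendsto_pow_atTop_nhds_zero_of_lt_one (by simp)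
    refine ge_of_tendsto' hlim fun n => ?_
    refine le_trans (measure_mono ?_) (hU.2 n)
    intro X hX
    simp only [Set.mem_ofPred_eq] at hX
    exact hX n
  exact this

lemma mem_agr_sum {Ω : Type*} [MeasurableSpace Ω] (P : Measure Ω) [IsProbabilityMeasure P]
    (F : Ω → Cantor) (hF : Measurable F) (hR : ∀ᵐ ω ∂P, F ω ∈ MLR) {d : Cantor}
    (hd : Computable d) :
    ∀ᶠ j : ℕ in Filter.atTop,
      ∑ i ∈ Finset.range (60 * j), P.real {ω | F ω i = d i} ≤ (71 / 2 : ℝ) * j := by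
  have hmi : ∀ i, MeasurableSet {ω | F ω i = d i} := fun i =>
    ((measurable_pi_apply i).comp hF) (measurableSet_singleton (d i))
  have hma : ∀ N, Measurable fun ω => (agr d (F ω) N : ℝ) := by
    intro N
    unfold agr
    push_cast
    exact Finset.measurable_sum _ fun i _ =>
      Measurable.ite (hmi i) measurable_const measurable_const
  let B : ℕ → Set Ω := fun j => {ω | (35 * j : ℝ) < agr d (F ω) (60 * j)}
  have hB : ∀ j, MeasurableSet (B j) := fun j => measurableSet_lt measurable_const (hma _)
  have hlim : Filter.Tendsto (fun j => P.real (B j)) Filter.atTop (nhds 0) := by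
    have h1 : Filter.Tendsto (fun j => ∫ ω, (B j).indicator (fun _ => (1 : ℝ)) ω ∂P) Filter.atTop
        (nhds (∫ _, (0 : ℝ) ∂P)) := by
      refine tendsto_integral_of_dominated_convergence (fun _ => (1 : ℝ))
        (fun j => (measurable_const.indicator (hB j)).aestronglyMeasurable)
        (integrable_const 1) ?_ ?_
      · intro j
        refine Filter.Eventually.of_forall fun ω => ?_
        by_cases h : ω ∈ B j <;> simp [h]
      · filter_upwards [hR] with ω hω
        obtain ⟨n, hn⟩ := mlr_freq hd hω
        refine tendsto_const_nhds.congr' ?_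
        filter_upwards [Filter.eventually_ge_atTop n] with j hj
        have : ω ∉ B j := by
          have := hn j hj
          simp only [B, Set.mem_ofPred_eq, not_lt]
          exact_mod_cast this
        simp [this]
    simpa [integral_indicator (hB _), measureReal_def] using h1
  filter_upwards [hlim.eventually (gt_mem_nhds (show (0 : ℝ) < 1 / 120 by norm_num))] with j hj
  have e : ∑ i ∈ Finset.range (60 * j), P.real {ω | F ω i = d i} =
      ∫ ω, (agr d (F ω) (60 * j) : ℝ) ∂P := by
    unfold agr
    push_cast
    rw [integral_finsetSum]
    · refine Finset.sum_congr rfl fun i _ => ?_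
      have : (fun ω => if F ω i = d i then (1 : ℝ) else 0) =
          {ω | F ω i = d i}.indicator (fun _ => (1 : ℝ)) := by
        funext ω
        simp [Set.indicator]
      rw [this, integral_indicator (hmi i)]
      simp [measureReal_def]
    · intro i _
      refine Integrable.of_bound (Measurable.ite (hmi i) measurable_const
        measurable_const).aestronglyMeasurable 1 (Filter.Eventually.of_forall fun ω => ?_)
      split_ifs <;> simp
  rw [e]
  calc ∫ ω, (agr d (F ω) (60 * j) : ℝ) ∂P
      ≤ ∫ ω, (35 * j + (60 * j) * (B j).indicator (fun _ => (1 : ℝ)) ω) ∂P := by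
        refine integral_mono ?_ ?_ ?_
        · refine Integrable.of_bound (hma _).aestronglyMeasurable (60 * j)
            (Filter.Eventually.of_forall fun ω => ?_)
          have := agr_le d (F ω) (60 * j)
          rw [Real.norm_of_nonneg (by positivity)]
          exact_mod_cast this
        · exact (integrable_const _).add
            (((integrable_const 1).indicator (hB j)).const_mul _)
        · intro ω
          by_cases h : ω ∈ B j
          · have := agr_le d (F ω) (60 * j)
            have h' : (agr d (F ω) (60 * j) : ℝ) ≤ 60 * j := by exact_mod_cast this
            simp only [h, Set.indicator_of_mem]
            have : (0 : ℝ) ≤ j := by positivity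
            linarith
          · have h' : (agr d (F ω) (60 * j) : ℝ) ≤ 35 * j := not_lt.1 h
            simpa [h] using h'
    _ = 35 * j + 60 * j * P.real (B j) := by
        rw [integral_add (integrable_const _)
          (((integrable_const 1).indicator (hB j)).const_mul _),
          integral_const_mul (60 * j : ℝ), integral_indicator (hB j)]
        simp [measureReal_def]
    _ ≤ 71 / 2 * j := by
        have : (0 : ℝ) ≤ j := by positivity
        nlinarith

/-- Column 0 is `A`, column 1 is `B`, the others are zero. -/
def joinK (k : ℕ) (A B : Cantor) : Cantor := fun n =>
  if n % k = 0 then A (n / k) else if n % k = 1 then B (n / k) else false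

/-- The zero real. -/
def zeroC : Cantor := fun _ => false

/-- A strict bound on the literals of a CNF. -/
def bnd (l : List (List ℕ)) : ℕ := l.flatten.foldr (fun a b => max a b) 0 + 1

lemma lt_bnd {l : List (List ℕ)} {cl : List ℕ} {n : ℕ} (h1 : cl ∈ l) (h2 : n ∈ cl) : n < bnd l := by
  have h : ∀ (t : List ℕ), n ∈ t → n ≤ t.foldr (fun a b => max a b) 0 := by
    intro t
    induction t with
    | nil => simp
    | cons a t ih =>
      intro h
      rcases List.mem_cons.1 h with rfl | h
      · simp
      · simp only [List.foldr_cons]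
        exact (ih h).trans (le_max_right _ _)
  exact Nat.lt_succ_of_le (h _ (List.mem_flatten.2 ⟨cl, h1, h2⟩))

/-- Evaluation of a CNF at the pattern `m` in column 0. -/
def evPat (k : ℕ) (l : List (List ℕ)) (m L : ℕ) : Prop :=
  ∀ cl ∈ l, ∃ n ∈ cl, n % k = 0 ∧ m / 2 ^ (L - 1 - n / k) % 2 = 1

instance (k : ℕ) (l : List (List ℕ)) (m L : ℕ) : Decidable (evPat k l m L) := by
  unfold evPat; infer_instance

/-- The majority value of a CNF when only column 0 is random. -/
def maj (k : ℕ) (l : List (List ℕ)) : Bool :=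
  decide (2 ^ bnd l < 2 * ((List.range (2 ^ bnd l)).filter
    (fun m => decide (evPat k l m (bnd l)))).length)

lemma primrec_maj (k : ℕ) : Primrec (maj k) := by
  have hpow : Primrec₂ (fun a b : ℕ => a ^ b) := Primrec₂.unpaired'.1 Nat.Primrec.pow
  have hbnd : Primrec bnd := by
    unfold bnd
    refine Primrec.nat_add.comp ?_ (Primrec.const 1)
    refine Primrec.list_foldr (h := fun _ p => max p.1 p.2) Primrec.list_flatten
      (Primrec.const 0) ?_
    exact Primrec.nat_max.comp (Primrec.fst.comp Primrec.snd) (Primrec.snd.comp Primrec.snd)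
  have h0 : PrimrecRel (fun (n : ℕ) (q : ℕ × ℕ) =>
      n % k = 0 ∧ q.1 / 2 ^ (q.2 - 1 - n / k) % 2 = 1) := by
    have hdiv : Primrec (fun r : ℕ × (ℕ × ℕ) => r.1 / k) :=
      Primrec.nat_div.comp Primrec.fst (Primrec.const k)
    refine PrimrecPred.and ?_ ?_
    · exact Primrec.eq.comp (Primrec.nat_mod.comp Primrec.fst (Primrec.const k)) (Primrec.const 0)
    · refine Primrec.eq.comp (Primrec.nat_mod.comp (Primrec.nat_div.comp
        (Primrec.fst.comp Primrec.snd) (hpow.comp (Primrec.const 2) ?_)) (Primrec.const 2))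
        (Primrec.const 1)
      exact Primrec.nat_sub.comp (Primrec.nat_sub.comp (Primrec.snd.comp Primrec.snd)
        (Primrec.const 1)) hdiv
  have h1 : PrimrecRel (fun (l : List (List ℕ)) (q : ℕ × ℕ) => evPat k l q.1 q.2) :=
    h0.exists_mem_list.forall_mem_list
  have h2 : PrimrecRel (fun (m : ℕ) (l : List (List ℕ)) => evPat k l m (bnd l)) :=
    h1.comp Primrec.snd (Primrec.pair Primrec.fst (hbnd.comp Primrec.snd))
  have h2p : Primrec (fun l => 2 ^ bnd l) := hpow.comp (Primrec.const 2) hbnd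
  have h3 : Primrec (fun l : List (List ℕ) => (List.range (2 ^ bnd l)).filter
      (fun m => decide (evPat k l m (bnd l)))) :=
    h2.listFilter.comp (Primrec.list_range.comp h2p) Primrec.id
  exact PrimrecPred.decide (Primrec.nat_lt.comp h2p
    (Primrec.nat_mul.comp (Primrec.const 2) (Primrec.list_length.comp h3)))

lemma posEval_true (c : ℕ → List (List ℕ)) (X : Cantor) (i : ℕ) :
    posEval c X i = true ↔ ∀ cl ∈ c i, ∃ n ∈ cl, X n = true := by
  simp [posEval]

lemma posEval_mono (c : ℕ → List (List ℕ)) {X Y : Cantor} (h : ∀ n, X n = true → Y n = true)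
    {i : ℕ} (hX : posEval c X i = true) : posEval c Y i = true := by
  rw [posEval_true] at *
  intro cl hcl
  obtain ⟨n, hn, hx⟩ := hX cl hcl
  exact ⟨n, hn, h n hx⟩

lemma joinK_zero_true {k : ℕ} {A : Cantor} {n : ℕ} :
    joinK k A zeroC n = true ↔ n % k = 0 ∧ A (n / k) = true := by
  unfold joinK zeroC
  split_ifs <;> simp [*]

lemma maj_spec (k : ℕ) (c : ℕ → List (List ℕ)) (i : ℕ) :
    fairCoin.real {A | posEval c (joinK k A zeroC) i = false} ≤
        fairCoin.real {A | posEval c (joinK k A zeroC) i = maj k (c i)} ∧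
    fairCoin.real {A | posEval c (joinK k A zeroC) i = true} ≤
        fairCoin.real {A | posEval c (joinK k A zeroC) i = maj k (c i)} := by
  set L := bnd (c i) with hL
  have hdep : ∀ X Y : Cantor, (∀ n < L, X n = Y n) →
      (posEval c (joinK k X zeroC) i = true ↔ posEval c (joinK k Y zeroC) i = true) := by
    have key : ∀ X Y : Cantor, (∀ n < L, X n = Y n) →
        posEval c (joinK k X zeroC) i = true → posEval c (joinK k Y zeroC) i = true := by
      intro X Y h hX
      rw [posEval_true] at *
      intro cl hcl
      obtain ⟨n, hn, hx⟩ := hX cl hcl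
      refine ⟨n, hn, ?_⟩
      rw [joinK_zero_true] at *
      refine ⟨hx.1, ?_⟩
      rw [← h (n / k) ((Nat.div_le_self n k).trans_lt (lt_bnd hcl hn))]
      exact hx.2
    exact fun X Y h => ⟨key X Y h, key Y X fun n hn => (h n hn).symm⟩
  have hm := meas_of_dep L _ hdep
  have hfc := fairCoin_dep L _ hdep
  have hcount : ((Finset.range (2 ^ L)).filter fun m =>
      posEval c (joinK k (pat L m) zeroC) i = true).card =
      ((List.range (2 ^ L)).filter (fun m => decide (evPat k (c i) m L))).length := by
    have : ((Finset.range (2 ^ L)).filter fun m =>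
      posEval c (joinK k (pat L m) zeroC) i = true) =
      (Finset.range (2 ^ L)).filter fun m => evPat k (c i) m L := by
      refine Finset.filter_congr fun m _ => ?_
      rw [posEval_true]
      simp only [joinK_zero_true, evPat, pat, decide_eq_true_eq]
    rw [this]
    rfl
  have hcompl : fairCoin.real {A | posEval c (joinK k A zeroC) i = false} =
      1 - fairCoin.real {A | posEval c (joinK k A zeroC) i = true} := by
    rw [← probReal_compl_eq_one_sub hm]
    congr 1
    ext A
    simp
  rw [hcount] at hfc
  set C := ((List.range (2 ^ L)).filter (fun m => decide (evPat k (c i) m L))).length with hC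
  have hpos : (0 : ℝ) < 2 ^ L := by positivity
  by_cases hlt : 2 ^ L < 2 * C
  · have hmaj : maj k (c i) = true := by
      unfold maj; exact decide_eq_true hlt
    rw [hmaj, hcompl, hfc]
    have h' : (2 : ℝ) ^ L < 2 * C := by exact_mod_cast hlt
    refine ⟨?_, le_rfl⟩
    have : (1 : ℝ) / 2 ≤ C / 2 ^ L := by
      rw [div_le_div_iff₀ (by norm_num) hpos]; linarith
    linarith
  · have hmaj : maj k (c i) = false := by
      unfold maj; exact decide_eq_false hlt
    rw [hmaj, hcompl, hfc]
    have h' : 2 * (C : ℝ) ≤ 2 ^ L := by exact_mod_cast not_lt.1 hlt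
    refine ⟨le_rfl, ?_⟩
    have : C / 2 ^ L ≤ (1 : ℝ) / 2 := by
      rw [div_le_div_iff₀ hpos (by norm_num)]; linarith
    linarith

lemma colK_zero {k : ℕ} (hk : 2 ≤ k) (A B : Cantor) : colK k (joinK k A B) 0 = A := by
  funext n
  have : 0 < k := by omega
  simp [colK, joinK, this]

lemma colK_one {k : ℕ} (hk : 2 ≤ k) (A B : Cantor) : colK k (joinK k A B) 1 = B := by
  funext n
  have h1 : (k * n + 1) % k = 1 := by
    rw [Nat.mul_add_mod, Nat.mod_eq_of_lt (by omega)]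
  have h2 : (k * n + 1) / k = n := by
    rw [Nat.mul_add_div (by omega), Nat.div_eq_of_lt (by omega), add_zero]
  simp [colK, joinK, h1, h2]

lemma measurable_joinK (k : ℕ) : Measurable (fun ω : Cantor × Cantor => joinK k ω.1 ω.2) := by
  refine measurable_pi_lambda _ fun n => ?_
  unfold joinK
  split_ifs
  · exact (measurable_pi_apply _).comp measurable_fst
  · exact (measurable_pi_apply _).comp measurable_snd
  · exact measurable_const

lemma measurable_posEval (c : ℕ → List (List ℕ)) : Measurable (posEval c) := by
  refine measurable_pi_lambda _ fun i => ?_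
  have hs : MeasurableSet {X : Cantor | posEval c X i = true} := by
    refine meas_of_dep (bnd (c i)) _ ?_
    have key : ∀ X Y : Cantor, (∀ n < bnd (c i), X n = Y n) →
        posEval c X i = true → posEval c Y i = true := by
      intro X Y h hX
      rw [posEval_true] at *
      intro cl hcl
      obtain ⟨n, hn, hx⟩ := hX cl hcl
      exact ⟨n, hn, (h n (lt_bnd hcl hn)) ▸ hx⟩
    exact fun X Y h => ⟨key X Y h, key Y X fun n hn => (h n hn).symm⟩
  exact measurable_to_bool hs

/-- For every `k ≥ 2`, MLR is not positively Medvedev reducible to `Some(MLR, k)`. -/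
theorem mlr_not_le_sp_someK_mlr (k : ℕ) (hk : 2 ≤ k) :
    ¬ ∃ c : ℕ → List (List ℕ), Computable c ∧
      ∀ X ∈ SomeK MLR k, posEval c X ∈ MLR := by
  rintro ⟨c, hc, hred⟩
  let P : Measure (Cantor × Cantor) := fairCoin.prod fairCoin
  have hJ := measurable_joinK k
  have hE := measurable_posEval c
  have mH : Measurable (fun ω : Cantor × Cantor => posEval c (joinK k ω.1 ω.2)) := hE.comp hJ
  have mF : Measurable (fun ω : Cantor × Cantor => posEval c (joinK k ω.1 zeroC)) :=
    mH.comp (measurable_fst.prodMk measurable_const)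
  have mG : Measurable (fun ω : Cantor × Cantor => posEval c (joinK k zeroC ω.2)) :=
    mH.comp (measurable_const.prodMk measurable_snd)
  have r1 : ∀ᵐ ω ∂P, ω.1 ∈ MLR := Measure.quasiMeasurePreserving_fst.ae ae_mlr
  have r2 : ∀ᵐ ω ∂P, ω.2 ∈ MLR := Measure.quasiMeasurePreserving_snd.ae ae_mlr
  have red0 : ∀ A B : Cantor, A ∈ MLR → posEval c (joinK k A B) ∈ MLR := fun A B hA =>
    hred _ ⟨0, by omega, by rw [colK_zero hk]; exact hA⟩
  have red1 : ∀ A B : Cantor, B ∈ MLR → posEval c (joinK k A B) ∈ MLR := fun A B hB =>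
    hred _ ⟨1, by omega, by rw [colK_one hk]; exact hB⟩
  have e1 := mem_agr_sum P _ mF (r1.mono fun ω h => red0 _ _ h)
    (d := fun _ => false) (Computable.const false)
  have e2 := mem_agr_sum P _ mG (r2.mono fun ω h => red1 _ _ h)
    (d := fun _ => false) (Computable.const false)
  have e3 := mem_agr_sum P _ mH (r1.mono fun ω h => red0 _ _ h)
    (d := fun _ => true) (Computable.const true)
  have e4 := mem_agr_sum P _ mF (r1.mono fun ω h => red0 _ _ h)
    (d := fun i => maj k (c i)) ((primrec_maj k).to_comp.comp hc)
  obtain ⟨j, h1, h2, h3, h4, hj⟩ :=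
    (e1.and (e2.and (e3.and (e4.and (Filter.eventually_ge_atTop 1))))).exists
  have fstEq : ∀ (i : ℕ) (b : Bool), P.real {ω | posEval c (joinK k ω.1 zeroC) i = b} =
      fairCoin.real {A | posEval c (joinK k A zeroC) i = b} := by
    intro i b
    have : {ω : Cantor × Cantor | posEval c (joinK k ω.1 zeroC) i = b} =
        {A | posEval c (joinK k A zeroC) i = b} ×ˢ Set.univ := by
      ext ω; simp
    rw [this, measureReal_prod_prod]
    simp
  have sndEq : ∀ (i : ℕ) (b : Bool), P.real {ω | posEval c (joinK k zeroC ω.2) i = b} =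
      fairCoin.real {B | posEval c (joinK k zeroC B) i = b} := by
    intro i b
    have : {ω : Cantor × Cantor | posEval c (joinK k zeroC ω.2) i = b} =
        Set.univ ×ˢ {B | posEval c (joinK k zeroC B) i = b} := by
      ext ω; simp
    rw [this, measureReal_prod_prod]
    simp
  have point : ∀ i : ℕ, (3 : ℝ) ≤
      2 * P.real {ω | posEval c (joinK k ω.1 ω.2) i = true} +
      P.real {ω | posEval c (joinK k ω.1 zeroC) i = false} +
      P.real {ω | posEval c (joinK k zeroC ω.2) i = false} +
      P.real {ω | posEval c (joinK k ω.1 zeroC) i = maj k (c i)} := by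
    intro i
    obtain ⟨m1, m2⟩ := maj_spec k c i
    rw [← fstEq, ← fstEq] at m1 m2
    have hmF : MeasurableSet {ω : Cantor × Cantor | posEval c (joinK k ω.1 zeroC) i = true} :=
      ((measurable_pi_apply i).comp mF) (measurableSet_singleton true)
    have hmH : MeasurableSet {ω : Cantor × Cantor | posEval c (joinK k ω.1 ω.2) i = true} :=
      ((measurable_pi_apply i).comp mH) (measurableSet_singleton true)
    have cF : P.real {ω | posEval c (joinK k ω.1 zeroC) i = false} =
        1 - P.real {ω | posEval c (joinK k ω.1 zeroC) i = true} := by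
      rw [← probReal_compl_eq_one_sub hmF]
      congr 1
      ext A
      simp
    have cH : P.real {ω | posEval c (joinK k ω.1 ω.2) i = false} =
        1 - P.real {ω | posEval c (joinK k ω.1 ω.2) i = true} := by
      rw [← probReal_compl_eq_one_sub hmH]
      congr 1
      ext A
      simp
    have hle : P.real {ω | posEval c (joinK k ω.1 ω.2) i = false} ≤
        P.real {ω | posEval c (joinK k ω.1 zeroC) i = false} *
        P.real {ω | posEval c (joinK k zeroC ω.2) i = false} := by
      rw [fstEq, sndEq, ← measureReal_prod_prod]
      refine measureReal_mono ?_ (measure_ne_top _ _)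
      rintro ⟨A, B⟩ h
      simp only [Set.mem_ofPred_eq, Set.mem_prod] at h ⊢
      constructor
      · by_contra hne
        rw [Bool.not_eq_false] at hne
        have := posEval_mono c (Y := joinK k A B) (fun n => ?_) hne
        · rw [h] at this; exact absurd this (by simp)
        · unfold joinK zeroC
          split_ifs <;> simp
      · by_contra hne
        rw [Bool.not_eq_false] at hne
        have := posEval_mono c (Y := joinK k A B) (fun n => ?_) hne
        · rw [h] at this; exact absurd this (by simp)
        · unfold joinK zeroC
          split_ifs <;> simp
    have hb0 : 0 ≤ P.real {ω | posEval c (joinK k zeroC ω.2) i = false} := measureReal_nonneg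
    have hb1 : P.real {ω | posEval c (joinK k zeroC ω.2) i = false} ≤ 1 := measureReal_le_one
    set a := P.real {ω | posEval c (joinK k ω.1 zeroC) i = false}
    set b := P.real {ω | posEval c (joinK k zeroC ω.2) i = false}
    set M := P.real {ω | posEval c (joinK k ω.1 zeroC) i = maj k (c i)}
    have k1 : 0 ≤ b * (M - a) := mul_nonneg hb0 (by linarith)
    have k2 : 0 ≤ (1 - b) * (a + M - 1) := mul_nonneg (by linarith) (by linarith)
    nlinarith
  have hsum := Finset.sum_le_sum (s := Finset.range (60 * j)) fun i _ => point i
  simp only [Finset.sum_add_distrib, ← Finset.mul_sum, Finset.sum_const, Finset.card_range,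
    nsmul_eq_mul] at hsum
  push_cast at hsum
  have hj' : (1 : ℝ) ≤ j := by exact_mod_cast hj
  linarith
end

section
/- MLR is not linearly Medvedev reducible to Some(MLR, ω): there is no linear reduction Φ such that Φ^X ∈ MLR for every X ∈ Some(MLR, ω). -/
open MeasureTheory

/-- The `i`-th column of `X`, via Mathlib's pairing bijection: `X_i(n) = X(⟨i,n⟩)`. -/
def col (X : Cantor) (i : ℕ) : Cantor := fun n => X (Nat.pair i n)

/-- `Some(C, ω)`: some column is in `C`. -/
def SomeOmega (C : Set Cantor) : Set Cantor := {X | ∃ i, col X i ∈ C}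

/-- `Many(C)`: infinitely many columns are in `C`. -/
def Many (C : Set Cantor) : Set Cantor := {X | {i | col X i ∈ C}.Infinite}

/-- The output `Φ^X` of the linear reduction given by query positions `q n` (distinct) and
constants `b n`: `Φ^X(n) = b n + Σ_{i ∈ q n} X(i)` with addition mod 2 (XOR). -/
def linEval (q : ℕ → List ℕ) (b : ℕ → Bool) (X : Cantor) : Cantor :=
  fun n => (q n).foldl (fun acc i => xor acc (X i)) (b n)

theorem digitMap_measurable : Measurable
    (fun (x : ℝ) (n : ℕ) => decide ((⌊x * 2 ^ (n + 1)⌋ % 2 : ℤ) = 1)) := by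
  refine measurable_pi_iff.2 fun n => ?_
  have h1 : Measurable (fun x : ℝ => ⌊x * 2 ^ (n+1)⌋) := by
    apply Int.measurable_floor.comp
    fun_prop
  have h2 : Measurable (fun z : ℤ => decide (z % 2 = 1)) := measurable_from_top
  exact h2.comp h1

theorem fairCoin_univ : fairCoin Set.univ = 1 := by
  unfold fairCoin
  rw [Measure.map_apply digitMap_measurable MeasurableSet.univ]
  simp

theorem floor_eq_of_digits (N : ℕ) (x y : ℝ) (hx : x ∈ Set.Ico (0:ℝ) 1) (hy : y ∈ Set.Ico (0:ℝ) 1)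
    (h : ∀ i < N, decide ((⌊x * 2 ^ (i + 1)⌋ % 2 : ℤ) = 1) = decide ((⌊y * 2 ^ (i + 1)⌋ % 2 : ℤ) = 1)) :
    ⌊x * 2 ^ N⌋ = ⌊y * 2 ^ N⌋ := by
  induction N with
  | zero =>
    rw [pow_zero, mul_one, mul_one, Int.floor_eq_zero_iff.2 hx, Int.floor_eq_zero_iff.2 hy]
  | succ N ih =>
    have ih' := ih fun i hi => h i (by omega)
    have hN := h N (by omega)
    have key : ∀ z : ℝ, ⌊z * 2 ^ (N+1)⌋ / 2 = ⌊z * 2 ^ N⌋ := by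
      intro z
      have := Int.floor_div_natCast (z * 2 ^ (N+1)) 2
      rw [show z * 2 ^ N = z * 2 ^ (N+1) / ((2:ℕ):ℝ) by push_cast; ring, this]
      rfl
    have kx := key x
    have ky := key y
    rw [decide_eq_decide] at hN
    omega

theorem fairCoin_prefix_le (N : ℕ) (f : ℕ → Bool) :
    fairCoin {X | ∀ i < N, X i = f i} ≤ ((2 : ENNReal) ^ N)⁻¹ := by
  have hm : MeasurableSet {X : Cantor | ∀ i < N, X i = f i} := by
    have : {X : Cantor | ∀ i < N, X i = f i} = ⋂ i, ⋂ (_ : i < N), (fun X => X i) ⁻¹' {f i} := by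
      ext X; simp
    rw [this]
    exact MeasurableSet.iInter fun i => MeasurableSet.iInter fun _ =>
      (measurable_pi_apply i) (measurableSet_singleton _)
  unfold fairCoin
  rw [Measure.map_apply digitMap_measurable hm, Measure.restrict_apply (digitMap_measurable hm)]
  by_cases he : ((fun (x : ℝ) (n : ℕ) => decide ((⌊x * 2 ^ (n + 1)⌋ % 2 : ℤ) = 1)) ⁻¹'
    {X | ∀ i < N, X i = f i} ∩ Set.Ico (0:ℝ) 1).Nonempty
  · obtain ⟨y, hy1, hy2⟩ := he
    set m := ⌊y * 2 ^ N⌋ with hmdef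
    have hp : (0:ℝ) < 2 ^ N := by positivity
    calc _ ≤ volume (Set.Ico ((m:ℝ) / 2 ^ N) ((m + 1 : ℝ) / 2 ^ N)) := by
          apply measure_mono
          rintro x ⟨hx1, hx2⟩
          have := floor_eq_of_digits N x y hx2 hy2 fun i hi => (hx1 i hi).trans (hy1 i hi).symm
          rw [← hmdef, Int.floor_eq_iff] at this
          exact ⟨(div_le_iff₀ hp).2 this.1, (lt_div_iff₀ hp).2 this.2⟩
      _ = _ := by
          rw [Real.volume_Ico, show ((m + 1 : ℝ) / 2 ^ N) - (m:ℝ) / 2 ^ N = (2 ^ N)⁻¹ by ring,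
            ENNReal.ofReal_inv_of_pos hp, ENNReal.ofReal_pow (by norm_num)]
          simp
  · rw [Set.not_nonempty_iff_eq_empty] at he
    rw [he]; simp

theorem fairCoin_fixed_le (P : Finset ℕ) (c : ℕ → Bool) :
    fairCoin {X | ∀ i ∈ P, X i = c i} ≤ ((2 : ENNReal) ^ P.card)⁻¹ := by
  obtain ⟨N, hN⟩ : ∃ N, P ⊆ Finset.range N := ⟨P.sup id + 1, fun i hi => by
    simpa [Nat.lt_succ_iff] using Finset.le_sup (f := id) hi⟩
  let S : Finset (Fin N → Bool) := Fintype.piFinset fun i =>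
    if (i : ℕ) ∈ P then {c i} else Finset.univ
  have hS : S.card = 2 ^ (N - P.card) := by
    rw [Fintype.card_piFinset, Fin.prod_univ_eq_prod_range
      (fun i => (if i ∈ P then ({c i} : Finset Bool) else Finset.univ).card) N]
    rw [Finset.prod_congr rfl (g := fun i => if i ∈ P then 1 else 2)
      (by intro i _; split_ifs <;> simp)]
    rw [Finset.prod_ite]
    simp only [Finset.prod_const_one, one_mul, Finset.prod_const]
    congr 1
    rw [← Finset.sdiff_eq_filter, Finset.card_sdiff_of_subset hN, Finset.card_range]
  have hcard : P.card ≤ N := by simpa using Finset.card_le_card hN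
  have hsub : {X : Cantor | ∀ i ∈ P, X i = c i} ⊆
      ⋃ f ∈ S, {X | ∀ i < N, X i = (fun j => if h : j < N then f ⟨j, h⟩ else false) i} := by
    intro X hX
    simp only [Set.mem_iUnion]
    refine ⟨fun i => X i, ?_, ?_⟩
    · simp only [S, Fintype.mem_piFinset]
      intro i
      split_ifs with h
      · simpa using hX _ h
      · simp
    · intro i hi
      simp [hi]
  calc _ ≤ _ := measure_mono hsub
    _ ≤ ∑ f ∈ S, _ := measure_biUnion_finset_le _ _
    _ ≤ ∑ f ∈ S, ((2 : ENNReal) ^ N)⁻¹ := Finset.sum_le_sum fun f _ => fairCoin_prefix_le N _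
    _ = _ := by
      rw [Finset.sum_const, hS, nsmul_eq_mul]
      push_cast
      obtain ⟨d, rfl⟩ := Nat.exists_eq_add_of_le hcard
      rw [Nat.add_sub_cancel_left, pow_add, ENNReal.mul_inv (by simp) (by simp), mul_comm, mul_assoc,
        ENNReal.inv_mul_cancel (by simp) (by simp), mul_one]

theorem MLR_nonempty : ∃ X, X ∈ MLR := by
  have hc : Countable {U : ℕ → ℕ → Option (List Bool) // Computable₂ U} := by
    let F : {U : ℕ → ℕ → Option (List Bool) // Computable₂ U} → {f : ℕ → ℕ // Computable f} :=
      fun U => ⟨fun n => Encodable.encode (U.1 n.unpair.1 n.unpair.2),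
        Computable.encode.comp (U.2.comp (Computable.fst.comp Computable.unpair)
          (Computable.snd.comp Computable.unpair))⟩
    apply Function.Injective.countable (f := F)
    intro U V h
    ext1; funext a b
    have := congrFun (congrArg Subtype.val h) (Nat.pair a b)
    simpa [F] using this
  have hc' : {U : ℕ → ℕ → Option (List Bool) | MLTest U}.Countable :=
    Set.Countable.mono (fun U hU => hU.1) (Set.countable_coe_iff.1 hc : {U | Computable₂ U}.Countable)
  have hz : fairCoin (⋃ U ∈ {U : ℕ → ℕ → Option (List Bool) | MLTest U}, ⋂ n, testSet U n) = 0 := by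
    rw [measure_biUnion_null_iff hc']
    intro U hU
    have hle : ∀ n, fairCoin (⋂ n, testSet U n) ≤ (2⁻¹ : ENNReal) ^ n := fun n => by
      rw [← ENNReal.inv_pow]
      exact (measure_mono (Set.iInter_subset _ n)).trans (hU.2 n)
    have ht := ENNReal.tendsto_pow_atTop_nhds_zero_of_lt_one (r := (2⁻¹ : ENNReal)) (by simp)
    exact le_antisymm (ge_of_tendsto' ht hle) zero_le
  by_contra hne
  push Not at hne
  have : (⋃ U ∈ {U : ℕ → ℕ → Option (List Bool) | MLTest U}, ⋂ n, testSet U n) = Set.univ := by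
    refine Set.eq_univ_of_forall fun X => ?_
    have := hne X
    simp only [MLR, Set.mem_ofPred_eq] at this
    push Not at this
    obtain ⟨U, hU, h⟩ := this
    simp only [Set.mem_iUnion, Set.mem_iInter]
    exact ⟨U, hU, h⟩
  rw [this, fairCoin_univ] at hz
  exact one_ne_zero hz

/-- Checks that `σ` has value `c j` at position `p j` for all `j < n`. -/
def chk (p : ℕ → ℕ) (c : ℕ → Bool) (n : ℕ) (σ : List Bool) : Bool :=
  Nat.rec true (fun j acc => acc && decide (σ[p j]? = some (c j))) n

theorem chk_iff (p : ℕ → ℕ) (c : ℕ → Bool) (n : ℕ) (σ : List Bool) :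
    chk p c n σ = true ↔ ∀ j < n, σ[p j]? = some (c j) := by
  induction n with
  | zero => simp [chk]
  | succ n ih =>
    have : chk p c (n+1) σ = (chk p c n σ && decide (σ[p n]? = some (c n))) := rfl
    rw [this, Bool.and_eq_true, ih, Nat.forall_lt_succ_right]
    simp

theorem chk_comp {p : ℕ → ℕ} {c : ℕ → Bool} (hp : Computable p) (hc : Computable c) :
    Computable fun a : ℕ × List Bool => chk p c a.1 a.2 := by
  unfold chk
  have hj : Computable fun z : (ℕ × List Bool) × (ℕ × Bool) => z.2.1 :=
    Computable.fst.comp Computable.snd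
  have heq : Computable₂ fun (a b : Option Bool) => decide (a = b) :=
    (Primrec.eq (α := Option Bool)).decide.to_comp
  refine Computable.nat_rec (h := fun (a : ℕ × List Bool) (z : ℕ × Bool) => z.2 && decide (a.2[p z.1]? = some (c z.1)))
    Computable.fst (Computable.const true) ?_
  refine (Primrec.and.to_comp : Computable₂ and).comp (Computable.snd.comp Computable.snd) ?_
  exact heq.comp (Computable.list_getElem?.comp (Computable.snd.comp Computable.fst) (hp.comp hj))
    (Computable.option_some.comp (hc.comp hj))

/-- The test associated with `p`, `c`. -/
def tst (p : ℕ → ℕ) (c : ℕ → Bool) (n k : ℕ) : Option (List Bool) :=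
  (Encodable.decode (α := List Bool) k).bind fun σ => bif chk p c n σ then some σ else none

theorem not_random {p : ℕ → ℕ} {c : ℕ → Bool} (hp : Computable p) (hc : Computable c)
    (hinj : Function.Injective p) {X : Cantor} (hX : ∀ j, X (p j) = c j) : X ∉ MLR := by
  have hset : ∀ n, testSet (tst p c) n = {X | ∀ j < n, X (p j) = c j} := by
    intro n
    ext Y
    simp only [testSet, Set.mem_iUnion, Set.mem_ofPred_eq]
    constructor
    · rintro ⟨σ, ⟨k, hk⟩, hY⟩ j hj
      simp only [tst, Option.bind_eq_some_iff] at hk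
      obtain ⟨τ, -, hτ⟩ := hk
      cases hch : chk p c n τ
      · simp [hch] at hτ
      · simp only [hch, cond_true, Option.some.injEq] at hτ
        subst hτ
        have := (chk_iff p c n τ).1 hch j hj
        obtain ⟨h, h'⟩ := List.getElem?_eq_some_iff.1 this
        rw [hY _ h]; exact h'
    · intro hY
      let σ : List Bool := List.ofFn fun i : Fin ((Finset.range n).sup p + 1) => Y i
      have hσ : chk p c n σ = true := by
        rw [chk_iff]
        intro j hj
        have : p j < (Finset.range n).sup p + 1 :=
          Nat.lt_succ_of_le (Finset.le_sup (f := p) (Finset.mem_range.2 hj))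
        rw [List.getElem?_eq_some_iff]
        refine ⟨by simpa [σ] using this, (List.getElem_ofFn _).trans (hY j hj)⟩
      refine ⟨σ, ⟨Encodable.encode σ, by simp [tst, hσ]⟩, ?_⟩
      intro i h
      exact (List.getElem_ofFn h).symm
  intro hM
  have hmt : MLTest (tst p c) := by
    refine ⟨?_, fun n => ?_⟩
    · show Computable fun z : ℕ × ℕ => (Encodable.decode (α := List Bool) z.2).bind
        fun σ => bif chk p c z.1 σ then some σ else none
      refine Computable.option_bind (g := fun (z : ℕ × ℕ) σ => bif chk p c z.1 σ then some σ else none)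
        (Computable.decode.comp Computable.snd) ?_
      have h2 : Computable fun z : (ℕ × ℕ) × List Bool => chk p c z.1.1 z.2 :=
        Computable.comp (f := fun a : ℕ × List Bool => chk p c a.1 a.2)
          (g := fun z : (ℕ × ℕ) × List Bool => (z.1.1, z.2)) (chk_comp hp hc)
          (Computable.pair (Computable.fst.comp Computable.fst) Computable.snd)
      show Computable fun z : (ℕ × ℕ) × List Bool => bif chk p c z.1.1 z.2 then some z.2 else none
      exact Computable.cond h2 (Computable.option_some.comp Computable.snd) (Computable.const none)
    · rw [hset]
      have := fairCoin_fixed_le ((Finset.range n).image p) (fun i => X i)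
      rw [Finset.card_image_of_injective _ hinj, Finset.card_range] at this
      refine le_trans (measure_mono ?_) this
      intro Y hY i hi
      obtain ⟨j, hj, rfl⟩ := Finset.mem_image.1 hi
      rw [hY j (Finset.mem_range.1 hj), hX]
  obtain ⟨n, hn⟩ := hM _ hmt
  rw [hset] at hn
  exact hn fun j _ => hX j

theorem exists_increasing {g : ℕ → ℕ} (hg : Computable g) (hu : ∀ B, ∃ n, B < g n) :
    ∃ p : ℕ → ℕ, Computable p ∧ StrictMono (fun j => g (p j)) ∧ ∀ j, 0 < g (p j) := by
  have hP : Partrec fun B : ℕ => Nat.rfind (fun n => (Part.some (decide (B < g n)) : Part Bool)) := by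
    apply Partrec.rfind
    have : Computable₂ fun (B n : ℕ) => decide (B < g n) :=
      (Primrec.nat_lt.decide.to_comp : Computable₂ fun a b : ℕ => decide (a < b)).comp
        Computable.fst (hg.comp Computable.snd)
    exact this.partrec₂
  have hex : ∀ B, ∃ n, n ∈ Nat.rfind (fun n => (Part.some (decide (B < g n)) : Part Bool)) := by
    intro B
    obtain ⟨m, hm⟩ := hu B
    obtain ⟨n, hn, -⟩ := Nat.rfind_min' (p := fun n => decide (B < g n)) (m := m) (by simpa using hm)
    exact ⟨n, hn⟩
  choose F hF using hex
  have hFc : Computable F := by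
    refine Partrec.of_eq hP fun B => ?_
    exact Part.eq_some_iff.2 (hF B)
  have hFs : ∀ B, B < g (F B) := fun B => by
    have := Nat.rfind_spec (hF B)
    simpa using this
  let p : ℕ → ℕ := fun n => Nat.rec (F 0) (fun _ y => F (g y)) n
  have hps : ∀ j, p (j+1) = F (g (p j)) := fun j => rfl
  have hmono : StrictMono (fun j => g (p j)) := strictMono_nat_of_lt_succ fun j => by
    rw [hps]; exact hFs _
  refine ⟨p, ?_, hmono, fun j => ?_⟩
  · refine Computable.nat_rec (f := fun n : ℕ => n) (g := fun _ => F 0) (h := fun _ z => F (g z.2))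
      Computable.id (Computable.const _) ?_
    exact hFc.comp (hg.comp (Computable.snd.comp Computable.snd))
  · exact lt_of_lt_of_le (hFs 0) (hmono.monotone (Nat.zero_le j))

/-- One plus the largest element of the list outside column `i`. -/
def topq (i : ℕ) (l : List ℕ) : ℕ :=
  l.foldl (fun acc x => if x.unpair.1 = i then acc else max acc (x + 1)) 0

theorem topq_comp (i : ℕ) : Computable (topq i) := by
  apply Primrec.to_comp
  refine Primrec.list_foldl (f := fun l : List ℕ => l) (g := fun _ => 0)
    (h := fun _ z => if z.2.unpair.1 = i then z.1 else max z.1 (z.2 + 1))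
    Primrec.id (Primrec.const 0) ?_
  have hx : Primrec fun z : List ℕ × (ℕ × ℕ) => z.2.2 := Primrec.snd.comp Primrec.snd
  have ha : Primrec fun z : List ℕ × (ℕ × ℕ) => z.2.1 := Primrec.fst.comp Primrec.snd
  refine Primrec.ite (Primrec.eq.comp (Primrec.fst.comp (Primrec.unpair.comp hx)) (Primrec.const i))
    ha (Primrec.nat_max.comp ha (Primrec.succ.comp hx))

theorem topq_aux (i : ℕ) (l : List ℕ) : ∀ a,
    let t := l.foldl (fun acc x => if x.unpair.1 = i then acc else max acc (x + 1)) a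
    a ≤ t ∧ (∀ x ∈ l, x.unpair.1 ≠ i → x < t) ∧
      (t = a ∨ ∃ x ∈ l, x.unpair.1 ≠ i ∧ x + 1 = t) := by
  induction l with
  | nil => simp
  | cons y l ih =>
    intro a
    simp only [List.foldl_cons]
    by_cases hy : y.unpair.1 = i
    · obtain ⟨h1, h2, h3⟩ := ih a
      simp only [hy, if_true]
      refine ⟨h1, ?_, ?_⟩
      · intro x hx hxi
        rcases List.mem_cons.1 hx with rfl | hx
        · exact absurd hy hxi
        · exact h2 x hx hxi
      · rcases h3 with h3 | ⟨x, hx, h⟩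
        · exact Or.inl h3
        · exact Or.inr ⟨x, List.mem_cons_of_mem _ hx, h⟩
    · obtain ⟨h1, h2, h3⟩ := ih (max a (y+1))
      simp only [hy, if_false]
      refine ⟨le_trans (le_max_left _ _) h1, ?_, ?_⟩
      · intro x hx hxi
        rcases List.mem_cons.1 hx with rfl | hx
        · exact lt_of_lt_of_le (Nat.lt_succ_self _) (le_trans (le_max_right _ _) h1)
        · exact h2 x hx hxi
      · rcases h3 with h3 | ⟨x, hx, h⟩
        · rcases le_total a (y+1) with h | h
          · right
            exact ⟨y, List.mem_cons_self, hy, by rw [h3, max_eq_right h]⟩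
          · left
            rw [h3, max_eq_left h]
        · exact Or.inr ⟨x, List.mem_cons_of_mem _ hx, h⟩

theorem lt_topq {i : ℕ} {l : List ℕ} {x : ℕ} (hx : x ∈ l) (hi : x.unpair.1 ≠ i) : x < topq i l :=
  (topq_aux i l 0).2.1 x hx hi

theorem exists_topq {i : ℕ} {l : List ℕ} (h : 0 < topq i l) :
    ∃ x ∈ l, x.unpair.1 ≠ i ∧ x + 1 = topq i l := by
  rcases (topq_aux i l 0).2.2 with h' | h'
  · exact absurd h' (Nat.ne_of_gt h)
  · exact h'

theorem foldl_xor_init (X : Cantor) (l : List ℕ) : ∀ b : Bool,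
    l.foldl (fun acc i => xor acc (X i)) b = xor b (l.foldl (fun acc i => xor acc (X i)) false) := by
  induction l with
  | nil => simp
  | cons y l ih =>
    intro b
    simp only [List.foldl_cons]
    rw [ih, ih (xor false (X y))]
    simp

/-- Course-of-values recursion. -/
def cov (G : ℕ → Cantor → Bool) (x : ℕ) : Bool :=
  G x (fun y => if _h : y < x then cov G y else false)
termination_by x

/-- Case A: unboundedly large queries outside column `i`. -/
theorem caseA {q : ℕ → List ℕ} {b : ℕ → Bool} (hq : Computable q) (hnd : ∀ n, (q n).Nodup) (i : ℕ)
    (hu : ∀ B, ∃ n, B < topq i (q n)) {Y : Cantor} :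
    ∃ X, col X i = Y ∧ linEval q b X ∉ MLR := by
  obtain ⟨p, hp, hmono, hpos⟩ := exists_increasing ((topq_comp i).comp hq) hu
  have hinj : Function.Injective p := fun a c h => hmono.injective (congrArg (fun n => topq i (q n)) h)
  choose v hv hvi hvt using fun j => exists_topq (hpos j)
  have hvinj : Function.Injective v := fun a c h => hmono.injective (by
    show topq i (q (p a)) = topq i (q (p c))
    rw [← hvt, ← hvt, h])
  classical
  let G : ℕ → Cantor → Bool := fun x f =>
    if x.unpair.1 = i then Y x.unpair.2 else
      if h : ∃ j, v j = x then
        ((q (p h.choose)).erase x).foldl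
          (fun acc y => xor acc (if y.unpair.1 = i then Y y.unpair.2 else f y)) (b (p h.choose))
      else false
  have hX : ∀ x, cov G x = G x (fun y => if _h : y < x then cov G y else false) := fun x => by
    rw [cov]
  have hXi : ∀ x, x.unpair.1 = i → cov G x = Y x.unpair.2 := fun x hx => by
    rw [hX]; simp only [G, hx, if_true]
  refine ⟨cov G, ?_, ?_⟩
  · funext n
    show cov G (Nat.pair i n) = Y n
    rw [hXi _ (by simp)]
    simp
  · refine not_random hp (Computable.const false) hinj fun j => ?_
    have hXv : cov G (v j) = ((q (p j)).erase (v j)).foldl (fun acc y => xor acc (cov G y)) (b (p j)) := by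
      rw [hX]
      have hex : ∃ k, v k = v j := ⟨j, rfl⟩
      have hch : hex.choose = j := hvinj hex.choose_spec
      simp only [G, hvi j, if_false]
      rw [dif_pos hex, hch]
      apply List.foldl_ext
      intro acc y hy
      congr 1
      have hy' := (List.Nodup.mem_erase_iff (hnd _)).1 hy
      split_ifs with h1 h2
      · exact (hXi y h1).symm
      · rfl
      · exfalso
        have := lt_topq hy'.2 h1
        have h3 := hvt j
        have h4 := hy'.1
        omega
    show (q (p j)).foldl (fun acc i => xor acc (cov G i)) (b (p j)) = false
    have : RightCommutative (fun (acc : Bool) (i : ℕ) => xor acc (cov G i)) :=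
      ⟨fun a c d => by cases a <;> cases cov G c <;> cases cov G d <;> rfl⟩
    rw [(List.perm_cons_erase (hv j)).foldl_eq, List.foldl_cons, foldl_xor_init, hXv,
      foldl_xor_init _ _ (b (p j))]
    generalize List.foldl _ false _ = t
    cases t <;> cases b (p j) <;> rfl

/-- Case B: all queries are bounded. -/
theorem caseB {q : ℕ → List ℕ} {b : ℕ → Bool} (hq : Computable q) (hb : Computable b)
    (hnd : ∀ n, (q n).Nodup) (B : ℕ) (hB : ∀ n, ∀ x ∈ q n, x < B) (X : Cantor) :
    linEval q b X ∉ MLR := by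
  have hfin : (Set.range q).Finite := by
    have : (⋃ s ∈ (Finset.range B).powerset, {l : List ℕ | l ∈ s.toList.permutations}).Finite :=
      Set.Finite.biUnion (Finset.finite_toSet _) fun s _ => List.finite_toSet _
    refine this.subset ?_
    rintro _ ⟨n, rfl⟩
    simp only [Set.mem_iUnion]
    refine ⟨(q n).toFinset, ?_, ?_⟩
    · rw [Finset.mem_powerset]
      intro x hx
      exact Finset.mem_range.2 (hB n x (List.mem_toFinset.1 hx))
    · show q n ∈ (q n).toFinset.toList.permutations
      rw [List.mem_permutations]
      exact (List.toFinset_toList (hnd n)).symm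
  obtain ⟨S, hS⟩ : ∃ S, {n | q n = S}.Infinite := by
    by_contra hcon
    push Not at hcon
    have : (Set.univ : Set ℕ).Finite := by
      refine (Set.Finite.biUnion hfin (t := fun S => {n | q n = S}) fun S _ => ?_).subset
        (fun n _ => Set.mem_biUnion ⟨n, rfl⟩ rfl)
      simpa using hcon S
    exact Set.infinite_univ this
  let g : ℕ → ℕ := fun n => bif decide (q n = S) then n + 1 else 0
  have hg : Computable g := by
    refine Computable.cond ?_ Computable.succ (Computable.const 0)
    exact ((Primrec.eq (α := List ℕ)).decide.to_comp : Computable₂ fun a b : List ℕ => decide (a = b)).comp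
      hq (Computable.const S)
  obtain ⟨p, hp, hmono, hpos⟩ := exists_increasing hg fun C => by
    obtain ⟨n, hn, hlt⟩ := hS.exists_gt C
    have hn' : q n = S := hn
    exact ⟨n, by simp [g, hn']; omega⟩
  have hpS : ∀ j, q (p j) = S := fun j => by
    by_contra h
    have := hpos j
    simp [g, h] at this
  have hinj : Function.Injective p := fun a c h => hmono.injective (congrArg g h)
  refine not_random (c := fun j => xor (b (p j)) (S.foldl (fun acc i => xor acc (X i)) false))
    hp ?_ hinj fun j => ?_
  · generalize S.foldl (fun acc i => xor acc (X i)) false = t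
    have ht : Primrec fun a : Bool => xor a t := Primrec.dom_finite _
    exact ht.to_comp.comp (hb.comp hp)
  · show (q (p j)).foldl (fun acc i => xor acc (X i)) (b (p j)) = _
    rw [hpS, foldl_xor_init]

/-- MLR is not linearly Medvedev reducible to `Some(MLR, ω)`. -/
theorem mlr_not_le_sl_someOmega_mlr :
    ¬ ∃ (q : ℕ → List ℕ) (b : ℕ → Bool),
      Computable q ∧ Computable b ∧ (∀ n, (q n).Nodup) ∧
      ∀ X ∈ SomeOmega MLR, linEval q b X ∈ MLR := by
  rintro ⟨q, b, hq, hb, hnd, hΦ⟩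
  obtain ⟨Y, hY⟩ := MLR_nonempty
  by_cases h : ∃ i, ∀ B, ∃ n, B < topq i (q n)
  · obtain ⟨i, hu⟩ := h
    obtain ⟨X, hX, hn⟩ := caseA (b := b) hq hnd i hu (Y := Y)
    exact hn (hΦ X ⟨i, by rw [hX]; exact hY⟩)
  · push Not at h
    obtain ⟨B0, h0⟩ := h 0
    obtain ⟨B1, h1⟩ := h 1
    let X : Cantor := fun n => Y n.unpair.2
    have hX : X ∈ SomeOmega MLR := ⟨0, by
      have : col X 0 = Y := by funext n; simp [col, X]
      rw [this]; exact hY⟩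
    refine caseB hq hb hnd (max B0 B1) (fun n x hx => ?_) X (hΦ X hX)
    by_cases hi : x.unpair.1 = 0
    · have := lt_topq (i := 1) hx (by omega)
      exact lt_of_lt_of_le this ((h1 n).trans (le_max_right _ _))
    · exact lt_of_lt_of_le (lt_topq hx hi) ((h0 n).trans (le_max_left _ _))
end

section
/- Suppose C ⊆ 2^ω and MLR ≤_{s,m} C, i.e., there is a computable f : ℕ → ℕ such that A∘f ∈ MLR for every A ∈ C. Then there is a strictly increasing computable g : ℕ → ℕ whose range has computable (decidable) membership, such that A∘g ∈ MLR for every A ∈ C. -/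
open MeasureTheory

theorem mem_cylinder_iff (σ : List Bool) (X : Cantor) :
    X ∈ cylinder σ ↔ ∀ i, i < σ.length → σ[i]? = some (X i) := by
  unfold _root_.cylinder
  constructor
  · intro h i hi
    rw [List.getElem?_eq_getElem hi, h i hi]; rfl
  · intro h i hi
    have := h i hi
    rw [List.getElem?_eq_getElem hi] at this
    simpa using (Option.some.inj this).symm

theorem mem_testSet_iff (U : ℕ → ℕ → Option (List Bool)) (n : ℕ) (X : Cantor) :
    X ∈ testSet U n ↔ ∃ k σ, U n k = some σ ∧ X ∈ cylinder σ := by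
  simp only [testSet, Set.mem_iUnion, Set.mem_ofPred_eq]
  constructor
  · rintro ⟨σ, ⟨k, hk⟩, hX⟩; exact ⟨k, σ, hk, hX⟩
  · rintro ⟨k, σ, hk, hX⟩; exact ⟨σ, ⟨k, hk⟩, hX⟩

/-- the binary digit map -/
noncomputable def digits (x : ℝ) (n : ℕ) : Bool := decide ((⌊x * 2 ^ (n + 1)⌋ % 2 : ℤ) = 1)

theorem measurable_digits : Measurable digits := by
  refine measurable_pi_iff.2 fun n => ?_
  have h1 : Measurable fun x : ℝ => ⌊x * 2 ^ (n + 1)⌋ :=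
    Int.measurable_floor.comp (measurable_id.mul_const _)
  exact (measurable_from_top (f := fun z : ℤ => decide ((z % 2 : ℤ) = 1))).comp h1

theorem cylinder_append (σ : List Bool) (b : Bool) (X : Cantor) :
    X ∈ cylinder (σ ++ [b]) ↔ X ∈ cylinder σ ∧ X σ.length = b := by
  simp only [mem_cylinder_iff]
  constructor
  · intro h
    refine ⟨fun i hi => ?_, ?_⟩
    · rw [← h i (by simp; omega), List.getElem?_append_left hi]
    · have := h σ.length (by simp)
      simpa using this.symm
  · rintro ⟨h, hb⟩ i hi
    simp at hi
    rcases lt_or_eq_of_le hi with h1 | h1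
    · rw [List.getElem?_append_left h1, h i h1]
    · subst h1; simp [hb]

theorem digits_cylinder (σ : List Bool) : ∃ k : ℤ, ∀ x : ℝ,
    (x ∈ Set.Ico (0:ℝ) 1 ∧ digits x ∈ cylinder σ) ↔ ⌊x * 2 ^ σ.length⌋ = k := by
  induction σ using List.reverseRecOn with
  | nil =>
    refine ⟨0, fun x => ?_⟩
    simp [mem_cylinder_iff, Int.floor_eq_iff]
  | append_singleton σ b ih =>
    obtain ⟨k, hk⟩ := ih
    refine ⟨2 * k + (if b then 1 else 0), fun x => ?_⟩
    rw [cylinder_append, ← and_assoc, hk]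
    have h2 : ⌊x * 2 ^ (σ.length + 1)⌋ / 2 = ⌊x * 2 ^ σ.length⌋ := by
      have := Int.mul_natCast_floor_div_cancel (n := 2) (by norm_num) (x * 2 ^ σ.length)
      rw [← this]; congr 2; push_cast; ring
    have hl : (σ ++ [b]).length = σ.length + 1 := by simp
    rw [hl, ← h2]
    unfold digits
    generalize ⌊x * 2 ^ (σ.length + 1)⌋ = z
    cases b <;> simp <;> omega

theorem measurableSet_cylinder (σ : List Bool) : MeasurableSet (cylinder σ) := by
  have : cylinder σ = ⋂ (i : ℕ) (h : i < σ.length), {X | X i = σ.get ⟨i, h⟩} := by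
    ext X; simp [_root_.cylinder]
  rw [this]
  refine MeasurableSet.iInter fun i => MeasurableSet.iInter fun h => ?_
  exact measurable_pi_apply i (measurableSet_singleton _)

theorem fairCoin_cylinder (σ : List Bool) :
    fairCoin (cylinder σ) = ((2 : ENNReal) ^ σ.length)⁻¹ := by
  obtain ⟨k, hk⟩ := digits_cylinder σ
  have : fairCoin = Measure.map digits (volume.restrict (Set.Ico (0 : ℝ) 1)) := rfl
  rw [this, Measure.map_apply measurable_digits (measurableSet_cylinder σ),
    Measure.restrict_apply (measurable_digits (measurableSet_cylinder σ))]
  have h2 : digits ⁻¹' cylinder σ ∩ Set.Ico (0:ℝ) 1 =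
      Set.Ico ((k:ℝ) / 2 ^ σ.length) ((k + 1) / 2 ^ σ.length) := by
    ext x
    rw [Set.mem_inter_iff, and_comm, Set.mem_preimage, hk, Int.floor_eq_iff, Set.mem_Ico,
      div_le_iff₀ (by positivity), lt_div_iff₀ (by positivity)]
  rw [h2, Real.volume_Ico, ← sub_div, add_sub_cancel_left, one_div,
    ENNReal.ofReal_inv_of_pos (by positivity), ENNReal.ofReal_pow (by norm_num)]
  simp

instance inst_s15 : IsProbabilityMeasure fairCoin := by
  constructor
  have := fairCoin_cylinder []
  have h : cylinder [] = Set.univ := by ext X; simp [_root_.cylinder]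
  simpa [h] using this

theorem isPiSystem_cylinder : IsPiSystem (Set.range cylinder) := by
  have key : ∀ σ τ : List Bool, σ.length ≤ τ.length → (cylinder σ ∩ cylinder τ).Nonempty →
      cylinder τ ⊆ cylinder σ := by
    rintro σ τ hl ⟨X, hs, ht⟩ Y hY
    rw [mem_cylinder_iff] at *
    intro i hi
    rw [hs i hi, ← ht i (by omega), hY i (by omega)]
  rintro _ ⟨σ, rfl⟩ _ ⟨τ, rfl⟩ hne
  rcases le_total σ.length τ.length with h | h
  · rw [Set.inter_eq_right.2 (key σ τ h hne)]; exact ⟨τ, rfl⟩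
  · rw [Set.inter_eq_left.2 (key τ σ h (by rwa [Set.inter_comm]))]; exact ⟨σ, rfl⟩

theorem mem_cylinder_ofFn (X : Cantor) (n : ℕ) :
    X ∈ cylinder ((List.range n).map X) := by
  rw [mem_cylinder_iff]
  intro i hi
  simp at hi
  simp [hi]

theorem generateFrom_cylinder :
    (inferInstance : MeasurableSpace Cantor) = MeasurableSpace.generateFrom (Set.range cylinder) := by
  apply le_antisymm
  · refine iSup_le fun i => ?_
    rintro _ ⟨A, -, rfl⟩
    have : (fun X : Cantor => X i) ⁻¹' A =
        ⋃ σ ∈ {σ : List Bool | ∃ b ∈ A, σ[i]? = some b}, cylinder σ := by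
      ext X
      simp only [Set.mem_preimage, Set.mem_iUnion, Set.mem_ofPred_eq]
      constructor
      · intro h
        exact ⟨(List.range (i+1)).map X, ⟨X i, h, by simp⟩, mem_cylinder_ofFn X _⟩
      · rintro ⟨σ, ⟨b, hb, hs⟩, hX⟩
        rw [mem_cylinder_iff] at hX
        have hi : i < σ.length := by
          by_contra hc
          rw [List.getElem?_eq_none (by omega)] at hs
          simp at hs
        rw [hX i hi] at hs
        rwa [Option.some.inj hs]
    rw [this]
    refine MeasurableSet.biUnion (Set.to_countable _) fun σ _ => ?_
    exact MeasurableSpace.measurableSet_generateFrom ⟨σ, rfl⟩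
  · refine MeasurableSpace.generateFrom_le ?_
    rintro _ ⟨σ, rfl⟩
    exact measurableSet_cylinder σ

/-- the fair coin on `Bool` -/
noncomputable def coin : Measure Bool := (PMF.uniformOfFintype Bool).toMeasure

instance : IsProbabilityMeasure coin := by unfold coin; infer_instance

theorem coin_singleton (b : Bool) : coin {b} = 2⁻¹ := by
  unfold coin
  rw [PMF.toMeasure_apply_singleton _ _ (measurableSet_singleton b)]
  simp

theorem fairCoin_eq : fairCoin = Measure.infinitePi (fun _ : ℕ => coin) := by
  refine ext_of_generate_finite _ generateFrom_cylinder isPiSystem_cylinder ?_ (by simp)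
  rintro _ ⟨σ, rfl⟩
  rw [fairCoin_cylinder]
  have : cylinder σ = Set.pi (Finset.range σ.length : Set ℕ) (fun i => {(σ[i]?).getD true}) := by
    ext X
    simp only [_root_.cylinder, Set.mem_ofPred_eq, Set.mem_pi, Finset.coe_range, Set.mem_Iio,
      Set.mem_singleton_iff]
    refine forall_congr' fun i => forall_congr' fun hi => ?_
    simp [hi]
  rw [this, Measure.infinitePi_pi _ (fun i _ => measurableSet_singleton _)]
  simp [coin_singleton, ENNReal.inv_pow]

theorem fairCoin_map_comp {h : ℕ → ℕ} (hh : Function.Injective h) :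
    fairCoin.map (fun X n => X (h n)) = fairCoin := by
  have hm : ∀ i : ℕ, Measurable (fun X : Cantor => X i) := fun i => measurable_pi_apply i
  have hmap : ∀ i, fairCoin.map (fun X : Cantor => X i) = coin := by
    intro i; rw [fairCoin_eq]; exact Measure.infinitePi_map_eval _ i
  have h1 : ProbabilityTheory.iIndepFun (fun (i : ℕ) (X : Cantor) => X i) fairCoin := by
    rw [ProbabilityTheory.iIndepFun_iff_map_fun_eq_infinitePi_map hm]
    simp only [hmap]
    rw [← fairCoin_eq]
    exact Measure.map_id
  have h2 := (h1.precomp hh).map_fun_eq_infinitePi_map (fun i => hm (h i))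
  simp only [hmap] at h2
  rw [h2, ← fairCoin_eq]

/-- unbounded search for total predicates is computable -/
theorem exists_computable_search {α : Type} [Primcodable α] {p : α → ℕ → Bool}
    (hp : Computable₂ p) (hex : ∀ a, ∃ n, p a n = true) :
    ∃ s : α → ℕ, Computable s ∧ ∀ a, p a (s a) = true ∧ ∀ m < s a, p a m = false := by
  classical
  refine ⟨fun a => Nat.find (hex a), ?_, fun a => ⟨Nat.find_spec (hex a), fun m hm => ?_⟩⟩
  · have h1 : Partrec fun a => Nat.rfind (fun n => Part.some (p a n)) :=
      Partrec.rfind (p := fun a n => Part.some (p a n)) hp.partrec₂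
    refine Partrec.of_eq h1 fun a => ?_
    refine Part.eq_some_iff.2 (Nat.mem_rfind.2 ⟨?_, fun {m} hm => ?_⟩)
    · simpa using (Nat.find_spec (hex a))
    · simpa using (Nat.find_min (hex a) hm)
  · simpa using (Nat.find_min (hex a) hm)

/-- bounded check that `τ ∘ h` agrees with `σ` below `n` -/
def agree (h : ℕ → ℕ) (σ τ : List Bool) (n : ℕ) : Bool :=
  Nat.rec (motive := fun _ => Bool) true (fun i b => b && decide (τ[h i]? = σ[i]?)) n

theorem agree_iff (h : ℕ → ℕ) (σ τ : List Bool) (n : ℕ) :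
    agree h σ τ n = true ↔ ∀ i < n, τ[h i]? = σ[i]? := by
  induction n with
  | zero => simp [agree]
  | succ n ih =>
    have : agree h σ τ (n + 1) = (agree h σ τ n && decide (τ[h n]? = σ[n]?)) := rfl
    rw [this, Bool.and_eq_true, ih, decide_eq_true_eq]
    constructor
    · rintro ⟨h1, h2⟩ i hi
      rcases Nat.lt_succ_iff_lt_or_eq.1 hi with h3 | rfl
      · exact h1 i h3
      · exact h2
    · intro h1
      exact ⟨fun i hi => h1 i (by omega), h1 n (by omega)⟩

theorem computable_agree {h : ℕ → ℕ} (hh : Computable h) :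
    Computable fun q : List Bool × List Bool => agree h q.1 q.2 q.1.length := by
  have hy : Computable fun z : (List Bool × List Bool) × (ℕ × Bool) => z.2.1 :=
    Computable.fst.comp Computable.snd
  have h1 : Computable fun z : (List Bool × List Bool) × (ℕ × Bool) => (z.1.2[h z.2.1]?) :=
    Computable.list_getElem?.comp (Computable.snd.comp Computable.fst) (hh.comp hy)
  have h2 : Computable fun z : (List Bool × List Bool) × (ℕ × Bool) => (z.1.1[z.2.1]?) :=
    Computable.list_getElem?.comp (Computable.fst.comp Computable.fst) hy
  have h3 : Computable fun z : (List Bool × List Bool) × (ℕ × Bool) =>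
      decide (z.1.2[h z.2.1]? = z.1.1[z.2.1]?) :=
    (Primrec.eq (α := Option Bool)).decide.to_comp.comp h1 h2
  have h4 : Computable fun z : (List Bool × List Bool) × (ℕ × Bool) =>
      z.2.2 && decide (z.1.2[h z.2.1]? = z.1.1[z.2.1]?) :=
    Primrec.and.to_comp.comp (Computable.snd.comp Computable.snd) h3
  have h5 : Computable₂ fun (q : List Bool × List Bool) (y : ℕ × Bool) =>
      y.2 && decide (q.2[h y.1]? = q.1[y.1]?) := h4.to₂
  have h6 := Computable.nat_rec
    (Computable.list_length.comp (Computable.fst (α := List Bool) (β := List Bool)))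
    (Computable.const true) h5
  exact h6

attribute [irreducible] agree

/-- output `τ` if it forces `σ` along `h` -/
def pullOut (h : ℕ → ℕ) (σ τ : List Bool) : Option (List Bool) :=
  bif agree h σ τ σ.length then some τ else none

theorem computable_pullOut {h : ℕ → ℕ} (hh : Computable h) : Computable₂ (pullOut h) := by
  have h2 := Computable.cond (computable_agree hh)
    (Computable.option_some.comp (Computable.snd (α := List Bool) (β := List Bool)))
    (Computable.const none)
  exact h2.to₂

attribute [irreducible] pullOut

/-- pullback of a test along `h`, with the index already decoded -/
def pullMid (h : ℕ → ℕ) (U : ℕ → ℕ → Option (List Bool)) (n : ℕ) (q : ℕ × List Bool) :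
    Option (List Bool) :=
  (U n q.1).bind fun σ => pullOut h σ q.2

theorem computable_pullMid {h : ℕ → ℕ} (hh : Computable h) {U : ℕ → ℕ → Option (List Bool)}
    (hU : Computable₂ U) : Computable₂ (pullMid h U) := by
  have hq : Computable fun z : (ℕ × (ℕ × List Bool)) × List Bool => z.1.2.2 :=
    Computable.snd.comp (Computable.snd.comp Computable.fst)
  have hs : Computable fun z : (ℕ × (ℕ × List Bool)) × List Bool => z.2 := Computable.snd
  have h2 : Computable fun z : (ℕ × (ℕ × List Bool)) × List Bool => pullOut h z.2 z.1.2.2 :=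
    (computable_pullOut hh).comp hs hq
  have h3 : Computable fun a : ℕ × (ℕ × List Bool) => U a.1 a.2.1 :=
    hU.comp Computable.fst (Computable.fst.comp Computable.snd)
  have h4 := Computable.option_bind h3 h2.to₂
  exact h4.to₂

/-- pullback of a test along `h` -/
def pullTest (h : ℕ → ℕ) (U : ℕ → ℕ → Option (List Bool)) (n k : ℕ) : Option (List Bool) :=
  (Encodable.decode (α := ℕ × List Bool) k).bind fun q => pullMid h U n q

theorem computable_pullTest {h : ℕ → ℕ} (hh : Computable h) {U : ℕ → ℕ → Option (List Bool)}
    (hU : Computable₂ U) : Computable₂ (pullTest h U) := by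
  have h5 : Computable fun a : ℕ × ℕ => Encodable.decode (α := ℕ × List Bool) a.2 :=
    Computable.decode.comp Computable.snd
  have h4 : Computable fun z : (ℕ × ℕ) × (ℕ × List Bool) => pullMid h U z.1.1 z.2 :=
    (computable_pullMid hh hU).comp (Computable.fst.comp Computable.fst) Computable.snd
  have h6 := Computable.option_bind h5 h4.to₂
  exact h6.to₂

theorem mem_pullTest {h : ℕ → ℕ} {U : ℕ → ℕ → Option (List Bool)} {n : ℕ} {X : Cantor} :
    X ∈ testSet (pullTest h U) n ↔ (fun i => X (h i)) ∈ testSet U n := by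
  simp only [mem_testSet_iff]
  constructor
  · rintro ⟨k, τ, hk, hX⟩
    simp only [pullTest, pullMid, pullOut, Option.bind_eq_some_iff] at hk
    obtain ⟨q, -, σ, hσ, hc⟩ := hk
    cases hag : agree h σ q.2 σ.length with
    | false => simp [hag] at hc
    | true =>
      simp only [hag, cond_true, Option.some.injEq] at hc
      subst hc
      rw [agree_iff] at hag
      refine ⟨q.1, σ, hσ, ?_⟩
      rw [mem_cylinder_iff] at hX ⊢
      intro i hi
      have h1 := hag i hi
      rw [← h1]
      apply hX
      by_contra hlt
      rw [List.getElem?_eq_none (by omega), List.getElem?_eq_getElem hi] at h1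
      simp at h1
  · rintro ⟨k, σ, hk, hX⟩
    let N := (Finset.range σ.length).sup h + 1
    let τ := (List.range N).map X
    refine ⟨Encodable.encode (k, τ), τ, ?_, mem_cylinder_ofFn X N⟩
    have hag : agree h σ τ σ.length = true := by
      rw [agree_iff]
      intro i hi
      rw [mem_cylinder_iff] at hX
      rw [hX i hi]
      have : h i < N := Nat.lt_succ_of_le (Finset.le_sup (f := h) (Finset.mem_range.2 hi))
      simp [τ, this]
    simp [pullTest, pullMid, pullOut, hk, hag]

theorem measurableSet_testSet (U : ℕ → ℕ → Option (List Bool)) (n : ℕ) :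
    MeasurableSet (testSet U n) :=
  MeasurableSet.biUnion (Set.to_countable _) fun σ _ => measurableSet_cylinder σ

theorem MLR_comp {X : Cantor} (hX : X ∈ MLR) {h : ℕ → ℕ} (hh : Computable h)
    (hi : Function.Injective h) : (fun n => X (h n)) ∈ MLR := by
  intro U hU
  have hT : MLTest (pullTest h U) := by
    refine ⟨computable_pullTest hh hU.1, fun n => ?_⟩
    have hm : Measurable fun (X : Cantor) (n : ℕ) => X (h n) :=
      measurable_pi_iff.2 fun i => measurable_pi_apply (h i)
    have h1 : testSet (pullTest h U) n =
        (fun (X : Cantor) (n : ℕ) => X (h n)) ⁻¹' testSet U n := by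
      ext X; exact mem_pullTest
    rw [h1, ← Measure.map_apply hm (measurableSet_testSet U n), fairCoin_map_comp hi]
    exact hU.2 n
  obtain ⟨n, hn⟩ := hX (pullTest h U) hT
  exact ⟨n, fun hc => hn (mem_pullTest.2 hc)⟩

/-- repeat every bit twice -/
def dbl (τ : List Bool) : List Bool := τ.flatMap fun b => [b, b]

theorem dbl_length (τ : List Bool) : (dbl τ).length = 2 * τ.length := by
  induction τ with
  | nil => rfl
  | cons a l ih => simp [dbl] at ih ⊢; omega

theorem dbl_append (τ : List Bool) (b : Bool) : dbl (τ ++ [b]) = dbl τ ++ [b] ++ [b] := by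
  simp [dbl]

/-- the test capturing sequences with `X (2i) = X (2i+1)` -/
def dblTest (n k : ℕ) : Option (List Bool) :=
  (Encodable.decode (α := List Bool) k).bind fun τ =>
    bif τ.length == n then some (dbl τ) else none

theorem computable_dblTest : Computable₂ dblTest := by
  unfold dblTest
  refine Computable.option_bind (α := ℕ × ℕ)
    (f := fun a => Encodable.decode (α := List Bool) a.2)
    (Computable.decode.comp Computable.snd) ?_
  refine Computable.cond (α := (ℕ × ℕ) × List Bool)
    (c := fun z => z.2.length == z.1.1) ?_ ?_ (Computable.const none)
  · exact (Primrec.beq (α := ℕ)).to_comp.comp (Computable.list_length.comp Computable.snd)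
      (Computable.fst.comp Computable.fst)
  · refine Computable.option_some.comp ?_
    have hd : Primrec dbl := by
      unfold dbl
      refine Primrec.list_flatMap Primrec.id ?_
      exact (Primrec.list_cons.comp Primrec.snd
        (Primrec.list_cons.comp Primrec.snd (Primrec.const [])))
    exact hd.to_comp.comp Computable.snd

theorem dblTest_eq_some {n k : ℕ} {σ : List Bool} (h : dblTest n k = some σ) :
    ∃ τ : List Bool, τ.length = n ∧ dbl τ = σ := by
  simp only [dblTest, Option.bind_eq_some_iff] at h
  obtain ⟨τ, -, hc⟩ := h
  by_cases hl : τ.length = n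
  · refine ⟨τ, hl, ?_⟩
    simpa [hl] using hc
  · have hb : (τ.length == n) = false := by simpa using hl
    rw [hb] at hc
    exact absurd hc (by simp)

theorem fairCoin_dblTest (n : ℕ) : fairCoin (testSet dblTest n) ≤ ((2 : ENNReal) ^ n)⁻¹ := by
  have h1 : testSet dblTest n ⊆ ⋃ v : List.Vector Bool n, cylinder (dbl v.1) := by
    intro X hX
    obtain ⟨k, σ, hk, hX⟩ := (mem_testSet_iff _ _ _).1 hX
    obtain ⟨τ, hl, rfl⟩ := dblTest_eq_some hk
    exact Set.mem_iUnion.2 ⟨⟨τ, hl⟩, hX⟩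
  refine (measure_mono h1).trans ((measure_iUnion_fintype_le _ _).trans ?_)
  have h2 : ∀ v : List.Vector Bool n, fairCoin (cylinder (dbl v.1)) = ((2 : ENNReal) ^ (2 * n))⁻¹ := by
    intro v
    rw [fairCoin_cylinder, dbl_length, v.2]
  simp only [h2, Finset.sum_const, Finset.card_univ, card_vector, Fintype.card_bool, nsmul_eq_mul]
  push_cast
  rw [two_mul, pow_add, ENNReal.mul_inv (by simp) (by simp), ← mul_assoc,
    ENNReal.mul_inv_cancel (by simp) (by simp), one_mul]

theorem not_MLR_of_double {X : Cantor} (hX : ∀ i, X (2 * i) = X (2 * i + 1)) : X ∉ MLR := by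
  intro h
  obtain ⟨n, hn⟩ := h dblTest ⟨computable_dblTest, fairCoin_dblTest⟩
  apply hn
  rw [mem_testSet_iff]
  let τ := (List.range n).map fun i => X (2 * i)
  refine ⟨Encodable.encode τ, dbl τ, by simp [dblTest, τ], ?_⟩
  have : ∀ m, X ∈ cylinder (dbl ((List.range m).map fun i => X (2 * i))) := by
    intro m
    induction m with
    | zero => rw [mem_cylinder_iff]; simp [dbl]
    | succ m ih =>
      rw [List.range_succ, List.map_append, List.map_singleton, dbl_append, cylinder_append,
        cylinder_append]
      refine ⟨⟨ih, ?_⟩, ?_⟩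
      · rw [dbl_length]; simp
      · rw [List.length_append, dbl_length]; simp [hX]
  exact this n

theorem computable_and {α : Type} [Primcodable α] {p q : α → Bool} (hp : Computable p)
    (hq : Computable q) : Computable fun a => p a && q a :=
  Primrec.and.to_comp.comp hp hq

theorem computable_lt {α : Type} [Primcodable α] {p q : α → ℕ} (hp : Computable p)
    (hq : Computable q) : Computable fun a => decide (p a < q a) :=
  (Primrec.nat_lt.decide.to_comp).comp hp hq

theorem computable_le {α : Type} [Primcodable α] {p q : α → ℕ} (hp : Computable p)
    (hq : Computable q) : Computable fun a => decide (p a ≤ q a) :=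
  (Primrec.nat_le.decide.to_comp).comp hp hq

theorem computable_beq {α : Type} [Primcodable α] {p q : α → ℕ} (hp : Computable p)
    (hq : Computable q) : Computable fun a => (p a == q a) :=
  (Primrec.beq (α := ℕ)).to_comp.comp hp hq

theorem computable_iter {s : ℕ → ℕ} (hs : Computable s) (a : ℕ) :
    Computable fun n : ℕ => Nat.rec (motive := fun _ => ℕ) a (fun _ r => s r) n :=
  Computable.nat_rec (f := fun n : ℕ => n) (g := fun _ => a) (h := fun _ y => s y.2)
    Computable.id (Computable.const a) (hs.comp (Computable.snd.comp Computable.snd))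

theorem eventually_injOn {f : ℕ → ℕ} (hf : Computable f) {A : Cantor}
    (hA : (fun n => A (f n)) ∈ MLR) : ∃ N, Set.InjOn f (Set.Ici N) := by
  by_contra hno
  push Not at hno
  have hex : ∀ N, ∃ m n, N < m ∧ m < n ∧ f m = f n := by
    intro N
    have := hno (N + 1)
    simp only [Set.InjOn, Set.mem_Ici] at this
    push Not at this
    obtain ⟨m, hm, n, hn, he, hne⟩ := this
    rcases lt_or_gt_of_ne hne with h | h
    · exact ⟨m, n, by omega, h, he⟩
    · exact ⟨n, m, by omega, h, he.symm⟩
  -- codes of pairs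
  let p : ℕ → ℕ → Bool := fun N c =>
    (decide (N < c.unpair.1) && decide (c.unpair.1 < c.unpair.2)) &&
      (f c.unpair.1 == f c.unpair.2)
  have hu1 : Computable fun c : ℕ => c.unpair.1 := (Primrec.fst.comp Primrec.unpair).to_comp
  have hu2 : Computable fun c : ℕ => c.unpair.2 := (Primrec.snd.comp Primrec.unpair).to_comp
  have hp : Computable₂ p := by
    have a1 : Computable fun z : ℕ × ℕ => z.2.unpair.1 := hu1.comp Computable.snd
    have a2 : Computable fun z : ℕ × ℕ => z.2.unpair.2 := hu2.comp Computable.snd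
    exact computable_and (computable_and (computable_lt Computable.fst a1) (computable_lt a1 a2))
      (computable_beq (hf.comp a1) (hf.comp a2))
  obtain ⟨s, hs, hsp⟩ := exists_computable_search hp (fun N => by
    obtain ⟨m, n, h1, h2, h3⟩ := hex N
    exact ⟨Nat.pair m n, by simp [p, h1, h2, h3]⟩)
  have hspec : ∀ N, N < (s N).unpair.1 ∧ (s N).unpair.1 < (s N).unpair.2 ∧
      f (s N).unpair.1 = f (s N).unpair.2 := by
    intro N
    have := (hsp N).1
    simp only [p, Bool.and_eq_true, decide_eq_true_eq, beq_iff_eq] at this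
    exact ⟨this.1.1, this.1.2, this.2⟩
  let q : ℕ → ℕ := fun n =>
    Nat.rec (motive := fun _ => ℕ) (s 0) (fun _ r => s r.unpair.2) n
  have hq : Computable q := computable_iter (s := fun r => s r.unpair.2) (hs.comp hu2) (s 0)
  have hqs : ∀ n, q (n + 1) = s (q n).unpair.2 := fun n => rfl
  have hqspec : ∀ n, ∃ N, q n = s N := by
    intro n
    cases n with
    | zero => exact ⟨0, rfl⟩
    | succ n => exact ⟨_, hqs n⟩
  let h : ℕ → ℕ := fun n => bif n % 2 == 0 then (q (n / 2)).unpair.1 else (q (n / 2)).unpair.2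
  have hhalf : Computable fun n : ℕ => q (n / 2) :=
    hq.comp (Primrec.nat_div.comp Primrec.id (Primrec.const 2)).to_comp
  have hh : Computable h :=
    Computable.cond (computable_beq
      (Primrec.nat_mod.comp Primrec.id (Primrec.const 2)).to_comp (Computable.const 0))
      (hu1.comp hhalf) (hu2.comp hhalf)
  have he : ∀ i, h (2 * i) = (q i).unpair.1 := by
    intro i
    simp [h]
  have ho : ∀ i, h (2 * i + 1) = (q i).unpair.2 := by
    intro i
    have h1 : (2 * i + 1) % 2 = 1 := by omega
    have h2 : (2 * i + 1) / 2 = i := by omega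
    simp [h, h1, h2]
  have hmono : StrictMono h := by
    refine strictMono_nat_of_lt_succ fun n => ?_
    rcases Nat.even_or_odd' n with ⟨i, rfl | rfl⟩
    · rw [he, ho]
      obtain ⟨N, hN⟩ := hqspec i
      rw [hN]; exact (hspec N).2.1
    · rw [ho, show 2 * i + 1 + 1 = 2 * (i + 1) by ring, he, hqs]
      exact (hspec _).1
  have hM := MLR_comp hA hh hmono.injective
  refine not_MLR_of_double (fun i => ?_) hM
  obtain ⟨N, hN⟩ := hqspec i
  simp only [he, ho, hN, (hspec N).2.2]

theorem computablePred_range {g : ℕ → ℕ} (hg : Computable g) (hm : StrictMono g) :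
    ComputablePred (fun n => n ∈ Set.range g) := by
  obtain ⟨s, hs, hsp⟩ := exists_computable_search (p := fun n k => decide (n ≤ g k))
    (computable_le Computable.fst (hg.comp Computable.snd))
    (fun n => ⟨n, by simpa using hm.le_apply⟩)
  rw [ComputablePred.computable_iff]
  refine ⟨fun n => g (s n) == n, computable_beq (hg.comp hs) Computable.id, ?_⟩
  funext n
  simp only [beq_iff_eq, Set.mem_range, eq_iff_iff]
  constructor
  · rintro ⟨k, rfl⟩
    have h1 := (hsp (g k)).1
    have h2 := (hsp (g k)).2
    simp only [decide_eq_true_eq, decide_eq_false_iff_not, not_le] at h1 h2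
    have h3 : k ≤ s (g k) := hm.le_iff_le.1 h1
    rcases lt_or_eq_of_le h3 with h4 | h4
    · exact absurd (h2 k h4) (lt_irrefl _)
    · rw [← h4]
  · intro h; exact ⟨_, h⟩

/-- If `MLR ≤_{s,m} C`, witnessed by a computable `f` with `A∘f ∈ MLR` for all `A ∈ C`,
then there is a strictly increasing computable `g` whose range has decidable membership,
with `A∘g ∈ MLR` for all `A ∈ C`. -/
theorem mlr_le_sm_gives_strictMono_reduction (C : Set Cantor)
    (f : ℕ → ℕ) (hf : Computable f) (hred : ∀ A ∈ C, (fun n => A (f n)) ∈ MLR) :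
    ∃ g : ℕ → ℕ, Computable g ∧ StrictMono g ∧
      ComputablePred (fun n => n ∈ Set.range g) ∧
      ∀ A ∈ C, (fun n => A (g n)) ∈ MLR := by
  rcases C.eq_empty_or_nonempty with rfl | ⟨A₀, hA₀⟩
  · exact ⟨id, Computable.id, strictMono_id, computablePred_range Computable.id strictMono_id,
      fun A hA => absurd hA (Set.notMem_empty A)⟩
  obtain ⟨N, hN⟩ := eventually_injOn hf (hred A₀ hA₀)
  -- above every `r`, some `k` beyond `r` and `N` has a larger value of `f`
  obtain ⟨s, hs, hsp⟩ := exists_computable_search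
    (p := fun r k => decide (r < k) && decide (f r < f k))
    (computable_and (computable_lt Computable.fst Computable.snd)
      (computable_lt (hf.comp Computable.fst) (hf.comp Computable.snd)))
    (fun r => by
      by_contra hc
      push Not at hc
      have hinj : Set.InjOn f (Set.Ioi (max r N)) :=
        hN.mono fun k hk => le_of_lt (lt_of_le_of_lt (le_max_right r N) hk)
      have hmaps : Set.MapsTo f (Set.Ioi (max r N)) (Set.Iic (f r)) := by
        intro k hk
        have hk' : r < k := lt_of_le_of_lt (le_max_left r N) hk
        have := hc k
        simpa [hk'] using this
      exact Set.Ioi_infinite (max r N)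
        (Set.Finite.of_injOn hmaps hinj (Set.finite_Iic (f r))))
  have hspec : ∀ r, r < s r ∧ f r < f (s r) := fun r => by
    have := (hsp r).1
    simpa using this
  let h : ℕ → ℕ := fun n => Nat.rec (motive := fun _ => ℕ) 0 (fun _ r => s r) n
  have hh : Computable h := computable_iter hs 0
  have hmono : StrictMono h := strictMono_nat_of_lt_succ fun n => (hspec (h n)).1
  have hgmono : StrictMono fun n => f (h n) :=
    strictMono_nat_of_lt_succ fun n => (hspec (h n)).2
  exact ⟨fun n => f (h n), hf.comp hh, hgmono, computablePred_range (hf.comp hh) hgmono,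
    fun A hA => MLR_comp (hred A hA) hh hmono.injective⟩
end
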